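/- arXiv:1105.0420 — 6 statements merged into one kernel-verified Lean document; each statement's English description precedes it below -/
import Mathlib

section
/- Let w and v be weight structures on a triangulated category C such that C_{v≤0} ⊆ C_{w≤0} and C_{v≥0} ⊆ C_{w≥0}. Then v = w, i.e. both inclusions are equalities. -/
namespace PaperWeights

open CategoryTheory CategoryTheory.Limits CategoryTheory.Pretriangulated CategoryTheory.Triangulated

universe v u

variable (C : Type u) [Category.{v} C] [HasZeroObject C] [Preadditive C] [HasShift C ℤ]
  [∀ n : ℤ, (shiftFunctor C n).Additive] [Pretriangulated C]

/-- A class of objects of a triangulated category is *extension-stable* if for every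
distinguished triangle `A ⟶ B ⟶ C`, `A ∈ D` and `C ∈ D` imply `B ∈ D`. -/
def ExtensionStable (D : Set C) : Prop :=
  ∀ T : Triangle C, (T ∈ distTriang C) → T.obj₁ ∈ D → T.obj₃ ∈ D → T.obj₂ ∈ D

/-- The pair of classes `(le, ge)`, playing the roles of `C_{w≤0}` and `C_{w≥0}`,
defines a weight structure on the triangulated category `C`. -/
structure IsWeightStructure (le ge : Set C) : Prop where
  retract_le : ∀ ⦃X Y : C⦄ (s : X ⟶ Y) (r : Y ⟶ X), s ≫ r = 𝟙 X → Y ∈ le → X ∈ le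
  retract_ge : ∀ ⦃X Y : C⦄ (s : X ⟶ Y) (r : Y ⟶ X), s ≫ r = 𝟙 X → Y ∈ ge → X ∈ ge
  zero_le : ∀ ⦃X : C⦄, IsZero X → X ∈ le
  zero_ge : ∀ ⦃X : C⦄, IsZero X → X ∈ ge
  sum_le : ∀ ⦃X Y : C⦄ (b : BinaryBicone X Y), b.IsBilimit → X ∈ le → Y ∈ le → b.pt ∈ le
  sum_ge : ∀ ⦃X Y : C⦄ (b : BinaryBicone X Y), b.IsBilimit → X ∈ ge → Y ∈ ge → b.pt ∈ ge
  shift_le : ∀ ⦃X : C⦄, X ∈ le → (X⟦(-1 : ℤ)⟧) ∈ le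
  shift_ge : ∀ ⦃X : C⦄, X ∈ ge → (X⟦(1 : ℤ)⟧) ∈ ge
  orthogonal : ∀ ⦃X Y : C⦄, X ∈ le → Y ∈ ge → ∀ f : X ⟶ (Y⟦(1 : ℤ)⟧), f = 0
  exists_decomp : ∀ M : C, ∃ (B A : C) (f : B ⟶ M) (g : M ⟶ A) (h : A ⟶ B⟦(1 : ℤ)⟧),
    B ∈ le ∧ (A⟦(-1 : ℤ)⟧) ∈ ge ∧ (Triangle.mk f g h ∈ distTriang C)

/-- The shift `P[i]` of a class of objects: `X ∈ P[i]` iff `X⟦-i⟧ ∈ P`.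
For a weight structure this gives `C_{w≤i} = C_{w≤0}[i]` and `C_{w≥i} = C_{w≥0}[i]`. -/
def shiftedClass (P : Set C) (i : ℤ) : Set C := fun X => (X⟦(-i)⟧) ∈ P

/-- `C_{w=i} = C_{w≤i} ∩ C_{w≥i}`. -/
def wEq (le ge : Set C) (i : ℤ) : Set C := shiftedClass C le i ∩ shiftedClass C ge i

/-- Boundedness of a weight structure. -/
def WBounded (le ge : Set C) : Prop :=
  ∀ X : C, (∃ i : ℤ, X ∈ shiftedClass C le i) ∧ (∃ i : ℤ, X ∈ shiftedClass C ge i)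

/-- The class `C^{t=0}` of a `t`-structure. -/
def heartSet (t : TStructure C) : Set C := fun X => t.le 0 X ∧ t.ge 0 X

/-- The heart of a `t`-structure, as a full subcategory. -/
abbrev THeart (t : TStructure C) := ObjectProperty.FullSubcategory (fun X : C => X ∈ heartSet C t)

/-- The inclusion of the heart. -/
abbrev heartIncl (t : TStructure C) : THeart C t ⥤ C :=
  ObjectProperty.ι (fun X : C => X ∈ heartSet C t)

/-- Boundedness of a `t`-structure. -/
def TBounded (t : TStructure C) : Prop :=
  ∀ X : C, (∃ n : ℤ, t.le n X) ∧ (∃ n : ℤ, t.ge n X)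

/-- A *nice decomposition* of `X ∈ C^{t=0}` for `m ∈ ℤ`: a distinguished triangle
`w_{≤m}X ⟶ X ⟶ w_{≥m+1}X ⟶ (w_{≤m}X)[1]` with `w_{≤m}X ∈ C_{w≤m} ∩ C^{t=0}` and
`w_{≥m+1}X ∈ C_{w≥m+1} ∩ C^{t=0}`. -/
def NiceDecomp (le ge : Set C) (t : TStructure C) (m : ℤ) (X : C) : Prop :=
  ∃ (W B : C) (f : W ⟶ X) (g : X ⟶ B) (h : B ⟶ W⟦(1 : ℤ)⟧),
    (Triangle.mk f g h ∈ distTriang C) ∧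
    W ∈ shiftedClass C le m ∧ B ∈ shiftedClass C ge (m + 1) ∧
    W ∈ heartSet C t ∧ B ∈ heartSet C t

/-- `t` and `w` are transversal: every object of the heart admits a nice
decomposition for every `m`. -/
def Transversal (le ge : Set C) (t : TStructure C) : Prop :=
  ∀ X ∈ heartSet C t, ∀ m : ℤ, NiceDecomp C le ge t m X

/-- If `w` and `v` are weight structures on `C` with
`C_{v≤0} ⊆ C_{w≤0}` and `C_{v≥0} ⊆ C_{w≥0}`, then `v = w`. -/
theorem statement2 (wle wge vle vge : Set C)
    (hw : IsWeightStructure C wle wge) (hv : IsWeightStructure C vle vge)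
    (hle : vle ⊆ wle) (hge : vge ⊆ wge) :
    vle = wle ∧ vge = wge := by
  refine ⟨Set.Subset.antisymm hle ?_, Set.Subset.antisymm hge ?_⟩
  · intro M hM
    obtain ⟨B, A, f, g, h, hB, hA, hT⟩ := hv.exists_decomp M
    let e : (A⟦(-1 : ℤ)⟧)⟦(1 : ℤ)⟧ ≅ A := (shiftFunctorCompIsoId C (-1 : ℤ) 1 (by simp)).app A
    have h0 : g ≫ e.inv = 0 := hw.orthogonal hM (hge hA) (g ≫ e.inv)
    have hg : g = 0 := by
      rw [← cancel_mono e.inv, h0, zero_comp]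
    obtain ⟨s, hs⟩ := Triangle.coyoneda_exact₂ _ hT (𝟙 M)
      (show 𝟙 M ≫ g = 0 by rw [hg, comp_zero])
    exact hv.retract_le s f hs.symm hB
  · intro M hM
    obtain ⟨B, A, f, g, h, hB, hA, hT⟩ := hv.exists_decomp (M⟦(1 : ℤ)⟧)
    have hf : f = 0 := hw.orthogonal (hle hB) hM f
    obtain ⟨r, hr⟩ := Triangle.yoneda_exact₂ _ hT (𝟙 (M⟦(1 : ℤ)⟧))
      (show f ≫ 𝟙 _ = 0 by rw [hf, zero_comp])
    change A ⟶ M⟦(1 : ℤ)⟧ at r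
    replace hr : 𝟙 (M⟦(1 : ℤ)⟧) = g ≫ r := hr
    let e : (M⟦(1 : ℤ)⟧)⟦(-1 : ℤ)⟧ ≅ M := (shiftFunctorCompIsoId C (1 : ℤ) (-1) (by simp)).app M
    refine hv.retract_ge (e.inv ≫ (shiftFunctor C (-1 : ℤ)).map g) ((shiftFunctor C (-1 : ℤ)).map r ≫ e.hom) ?_ hA
    rw [Category.assoc, ← Category.assoc ((shiftFunctor C (-1 : ℤ)).map g), ← Functor.map_comp, ← hr,
      CategoryTheory.Functor.map_id, Category.id_comp, e.inv_hom_id]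

end PaperWeights
end

section
/- Let w be a bounded weight structure on a triangulated category C. Then C_{w≤0} is the smallest extension-stable subclass of Obj C containing ∪_{i≤0} C_{w=i}, and C_{w≥0} is the smallest extension-stable subclass of Obj C containing ∪_{i≥0} C_{w=i}. -/
namespace PaperWeights

open CategoryTheory CategoryTheory.Limits CategoryTheory.Pretriangulated CategoryTheory.Triangulated

universe v u

variable (C : Type u) [Category.{v} C] [HasZeroObject C] [Preadditive C] [HasShift C ℤ]
  [∀ n : ℤ, (shiftFunctor C n).Additive] [Pretriangulated C]

variable {C}

lemma le_of_hom {le ge : Set C} (hw : IsWeightStructure C le ge) {X : C}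
    (h : ∀ Y ∈ ge, ∀ f : X ⟶ Y⟦(1 : ℤ)⟧, f = 0) : X ∈ le := by
  obtain ⟨B, A, f, g, d, hB, hA, hT⟩ := hw.exists_decomp X
  have hg : g = 0 := by
    have e : (A⟦(-1 : ℤ)⟧)⟦(1 : ℤ)⟧ ≅ A := (shiftFunctorCompIsoId C (-1 : ℤ) 1 (by simp)).app A
    have := h _ hA (g ≫ e.inv)
    rw [← cancel_mono e.inv, this, zero_comp]
  obtain ⟨s, hs⟩ := Triangle.coyoneda_exact₂ _ hT (𝟙 X) ((Category.id_comp g).trans hg)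
  exact hw.retract_le s f hs.symm hB

lemma ge_of_hom {le ge : Set C} (hw : IsWeightStructure C le ge) {Y : C}
    (h : ∀ X ∈ le, ∀ f : X ⟶ Y⟦(1 : ℤ)⟧, f = 0) : Y ∈ ge := by
  obtain ⟨B, A, f, g, d, hB, hA, hT⟩ := hw.exists_decomp (Y⟦(1 : ℤ)⟧)
  have hf : f = 0 := h _ hB f
  obtain ⟨(r : A ⟶ Y⟦(1 : ℤ)⟧), hr⟩ := Triangle.yoneda_exact₂ _ hT (𝟙 (Y⟦(1 : ℤ)⟧)) ((Category.comp_id f).trans hf)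
  have e : (Y⟦(1 : ℤ)⟧)⟦(-1 : ℤ)⟧ ≅ Y := (shiftFunctorCompIsoId C (1 : ℤ) (-1) (by simp)).app Y
  refine hw.retract_ge (e.inv ≫ g⟦(-1 : ℤ)⟧') (r⟦(-1 : ℤ)⟧' ≫ e.hom) ?_ hA
  have hr' : g ≫ r = 𝟙 _ := hr.symm
  rw [Category.assoc, ← Functor.map_comp_assoc, hr']
  simp

lemma ext_le {le ge : Set C} (hw : IsWeightStructure C le ge) : ExtensionStable C le := by
  intro T hT h1 h3
  refine le_of_hom hw fun Y hY f => ?_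
  obtain ⟨g, hg⟩ := Triangle.yoneda_exact₂ T hT f (hw.orthogonal h1 hY _)
  rw [hg, hw.orthogonal h3 hY g, comp_zero]

lemma ext_ge {le ge : Set C} (hw : IsWeightStructure C le ge) : ExtensionStable C ge := by
  intro T hT h1 h3
  refine ge_of_hom hw fun X hX f => ?_
  obtain ⟨g, hg⟩ := Triangle.coyoneda_exact₂ _ (Triangle.shift_distinguished T hT 1) f
    (hw.orthogonal hX h3 _)
  have h0 : g = 0 := hw.orthogonal hX h1 g
  rw [hg, h0]
  exact zero_comp

/-- Closure under isomorphisms. -/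
def IsoClosed (P : Set C) : Prop := ∀ ⦃X Y : C⦄, (X ≅ Y) → X ∈ P → Y ∈ P

lemma iso_le {le ge : Set C} (hw : IsWeightStructure C le ge) : IsoClosed le :=
  fun _ _ e h => hw.retract_le e.inv e.hom (by simp) h

lemma iso_ge {le ge : Set C} (hw : IsWeightStructure C le ge) : IsoClosed ge :=
  fun _ _ e h => hw.retract_ge e.inv e.hom (by simp) h

lemma shift_mem {P : Set C} (hP : IsoClosed P) {X : C} {k n m : ℤ} (h : m + k = n) :
    X⟦k⟧ ∈ shiftedClass C P n ↔ X ∈ shiftedClass C P m := by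
  have e : (X⟦k⟧)⟦-n⟧ ≅ X⟦-m⟧ := ((shiftFunctorAdd' C k (-n) (-m) (by omega)).app X).symm
  exact ⟨fun H => hP e H, fun H => hP e.symm H⟩

lemma mem_zero {P : Set C} (hP : IsoClosed P) {X : C} :
    X ∈ shiftedClass C P 0 ↔ X ∈ P := by
  have e : X⟦-(0 : ℤ)⟧ ≅ X := (shiftFunctorZero' C (-(0 : ℤ)) (by simp)).app X
  exact ⟨fun H => hP e H, fun H => hP e.symm H⟩

lemma iso_shifted {P : Set C} (hP : IsoClosed P) (n : ℤ) : IsoClosed (shiftedClass C P n) :=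
  fun _ _ e h => hP ((shiftFunctor C (-n)).mapIso e) h

lemma ext_shifted {P : Set C} (hP : ExtensionStable C P) (n : ℤ) :
    ExtensionStable C (shiftedClass C P n) :=
  fun T hT h1 h3 => hP _ (Triangle.shift_distinguished T hT (-n)) h1 h3

lemma mono_le {le ge : Set C} (hw : IsWeightStructure C le ge) {X : C} {n m : ℤ} (h : n ≤ m)
    (hX : X ∈ shiftedClass C le n) : X ∈ shiftedClass C le m := by
  induction m, h using Int.leInduction with
  | base => exact hX
  | succ m _ ih =>
    have e : (X⟦-m⟧)⟦(-1 : ℤ)⟧ ≅ X⟦-(m + 1)⟧ :=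
      ((shiftFunctorAdd' C (-m) (-1) (-(m + 1)) (by omega)).app X).symm
    exact iso_le hw e (hw.shift_le ih)

lemma mono_ge {le ge : Set C} (hw : IsWeightStructure C le ge) {X : C} {n m : ℤ} (h : m ≤ n)
    (hX : X ∈ shiftedClass C ge n) : X ∈ shiftedClass C ge m := by
  induction m, h using Int.leInductionDown with
  | base => exact hX
  | pred m _ ih =>
    have e : (X⟦-m⟧)⟦(1 : ℤ)⟧ ≅ X⟦-(m - 1)⟧ :=
      ((shiftFunctorAdd' C (-m) 1 (-(m - 1)) (by omega)).app X).symm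
    exact iso_ge hw e (hw.shift_ge ih)

lemma dist_of_iso {T : Triangle C} (hT : T ∈ distTriang C) {M : C} (e : T.obj₂ ≅ M) :
    Triangle.mk (T.mor₁ ≫ e.hom) (e.inv ≫ T.mor₂) T.mor₃ ∈ distTriang C := by
  have h1 : (T.mor₁ ≫ e.hom) ≫ e.inv = 𝟙 T.obj₁ ≫ T.mor₁ := by simp
  have h2 : (e.inv ≫ T.mor₂) ≫ 𝟙 T.obj₃ = e.inv ≫ T.mor₂ := by simp
  have h3 : T.mor₃ ≫ (𝟙 T.obj₁)⟦(1 : ℤ)⟧' = 𝟙 T.obj₃ ≫ T.mor₃ := by simp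
  exact isomorphic_distinguished _ hT _ (Triangle.isoMk _ _ (Iso.refl T.obj₁) e.symm
    (Iso.refl T.obj₃) h1 h2 h3)

lemma decomp {le ge : Set C} (hw : IsWeightStructure C le ge) (M : C) (n : ℤ) :
    ∃ (B A : C) (f : B ⟶ M) (g : M ⟶ A) (h : A ⟶ B⟦(1 : ℤ)⟧),
      B ∈ shiftedClass C le n ∧ A ∈ shiftedClass C ge (n + 1) ∧
        (Triangle.mk f g h ∈ distTriang C) := by
  obtain ⟨B, A, f, g, d, hB, hA, hT⟩ := hw.exists_decomp (M⟦-n⟧)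
  have hT' := Triangle.shift_distinguished _ hT n
  have e : (M⟦-n⟧)⟦n⟧ ≅ M := (shiftFunctorCompIsoId C (-n) n (by simp)).app M
  let T := (Triangle.shiftFunctor C n).obj (Triangle.mk f g d)
  let e' : T.obj₂ ≅ M := e
  refine ⟨B⟦n⟧, A⟦n⟧, T.mor₁ ≫ e'.hom, e'.inv ≫ T.mor₂, T.mor₃,
    (shift_mem (iso_le hw) (zero_add n)).2 ((mem_zero (iso_le hw)).2 hB),
    (shift_mem (iso_ge hw) (add_comm 1 n)).2 hA, ?_⟩
  exact dist_of_iso hT' e'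

lemma ge_fst {le ge : Set C} (hw : IsWeightStructure C le ge) {T : Triangle C}
    (hT : T ∈ distTriang C) {n : ℤ} (h2 : T.obj₂ ∈ shiftedClass C ge n)
    (h3 : T.obj₃ ∈ shiftedClass C ge (n + 1)) : T.obj₁ ∈ shiftedClass C ge n :=
  ext_shifted (ext_ge hw) n _ (inv_rot_of_distTriang _ hT)
    ((shift_mem (iso_ge hw) (by omega)).2 h3) h2

lemma le_trd {le ge : Set C} (hw : IsWeightStructure C le ge) {T : Triangle C}
    (hT : T ∈ distTriang C) {n : ℤ} (h2 : T.obj₂ ∈ shiftedClass C le (n + 1))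
    (h1 : T.obj₁ ∈ shiftedClass C le n) : T.obj₃ ∈ shiftedClass C le (n + 1) :=
  ext_shifted (ext_le hw) (n + 1) _ (rot_of_distTriang _ hT) h2
    ((shift_mem (iso_le hw) rfl).2 h1)

lemma min_le {le ge : Set C} (hw : IsWeightStructure C le ge) {D : Set C}
    (hD : ExtensionStable C D) (hsub : ∀ i : ℤ, i ≤ 0 → wEq C le ge i ⊆ D) (n : ℕ) :
    ∀ X : C, X ∈ shiftedClass C le 0 → X ∈ shiftedClass C ge (-(n : ℤ)) → X ∈ D := by
  induction n with
  | zero => exact fun X h1 h2 => hsub 0 le_rfl ⟨h1, by simpa using h2⟩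
  | succ n ih =>
    intro X h1 h2
    obtain ⟨B, A, f, g, d, hB, hA, hT⟩ := decomp hw X (-((n + 1 : ℕ) : ℤ))
    have hBD : B ∈ D := hsub (-((n + 1 : ℕ) : ℤ)) (by omega) ⟨hB, ge_fst hw hT h2 hA⟩
    have hA0 : A ∈ shiftedClass C le (-1 + 1) :=
      le_trd hw hT (n := -1) h1 (mono_le hw (by omega) hB)
    exact hD _ hT hBD (ih A hA0 (mono_ge hw (by omega) hA))

lemma min_ge {le ge : Set C} (hw : IsWeightStructure C le ge) {D : Set C}
    (hD : ExtensionStable C D) (hsub : ∀ i : ℤ, 0 ≤ i → wEq C le ge i ⊆ D) (n : ℕ) :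
    ∀ X : C, X ∈ shiftedClass C ge 0 → X ∈ shiftedClass C le (n : ℤ) → X ∈ D := by
  induction n with
  | zero => exact fun X h1 h2 => hsub 0 le_rfl ⟨by simpa using h2, h1⟩
  | succ n ih =>
    intro X h1 h2
    obtain ⟨B, A, f, g, d, hB, hA, hT⟩ := decomp hw X (n : ℤ)
    have hAD : A ∈ D := hsub ((n : ℤ) + 1) (by omega)
      ⟨le_trd hw hT (n := (n : ℤ)) (by exact_mod_cast h2) hB, hA⟩
    have hB0 : B ∈ shiftedClass C ge 0 :=
      ge_fst hw hT h1 (mono_ge hw (by omega) hA)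
    exact hD _ hT (ih B hB0 hB) hAD

variable (C)

/-- For a bounded weight structure `w` on `C`, the class `C_{w≤0}`
is the smallest extension-stable subclass of `Obj C` containing `∪_{i≤0} C_{w=i}`,
and `C_{w≥0}` is the smallest extension-stable subclass containing `∪_{i≥0} C_{w=i}`. -/
theorem statement3 (le ge : Set C) (hw : IsWeightStructure C le ge)
    (hb : WBounded C le ge) :
    ((⋃ i : ℤ, ⋃ (_ : i ≤ 0), wEq C le ge i) ⊆ le ∧ ExtensionStable C le ∧
      (∀ D : Set C, ExtensionStable C D →
        (⋃ i : ℤ, ⋃ (_ : i ≤ 0), wEq C le ge i) ⊆ D → le ⊆ D)) ∧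
    ((⋃ i : ℤ, ⋃ (_ : 0 ≤ i), wEq C le ge i) ⊆ ge ∧ ExtensionStable C ge ∧
      (∀ D : Set C, ExtensionStable C D →
        (⋃ i : ℤ, ⋃ (_ : 0 ≤ i), wEq C le ge i) ⊆ D → ge ⊆ D)) := by
  refine ⟨⟨?_, ext_le hw, ?_⟩, ⟨?_, ext_ge hw, ?_⟩⟩
  · intro X hX
    simp only [Set.mem_iUnion] at hX
    obtain ⟨i, hi, hX⟩ := hX
    exact (mem_zero (iso_le hw)).1 (mono_le hw hi hX.1)
  · intro D hD hsub X hX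
    obtain ⟨i, hi⟩ := (hb X).2
    exact min_le hw hD (fun i hi Y hY => hsub (Set.mem_iUnion₂.2 ⟨i, hi, hY⟩)) i.natAbs X
      ((mem_zero (iso_le hw)).2 hX) (mono_ge hw (by omega) hi)
  · intro X hX
    simp only [Set.mem_iUnion] at hX
    obtain ⟨i, hi, hX⟩ := hX
    exact (mem_zero (iso_ge hw)).1 (mono_ge hw hi hX.2)
  · intro D hD hsub X hX
    obtain ⟨i, hi⟩ := (hb X).1
    exact min_ge hw hD (fun i hi Y hY => hsub (Set.mem_iUnion₂.2 ⟨i, hi, hY⟩)) i.natAbs X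
      ((mem_zero (iso_ge hw)).2 hX) (mono_le hw (by omega) hi)

end PaperWeights
end

section
/- Fix a triangulated category C with a weight structure w and a t-structure t, and fix m ∈ ℤ. Suppose that every object of a subclass N ⊆ C^{t=0} admits a nice decomposition for m. Let N' ⊆ C^{t=0} be the smallest subclass containing N satisfying: whenever A, C ∈ N' and A →f B →g C is a complex in the heart Ht (g∘f = 0) with f a monomorphism, g an epimorphism, and Ker g/Im f ∈ N', then B ∈ N'. Then every object of N' admits a nice decomposition for m. -/
namespace PaperWeights

open CategoryTheory CategoryTheory.Limits CategoryTheory.Pretriangulated CategoryTheory.Triangulated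

universe v u

variable (C : Type u) [Category.{v} C] [HasZeroObject C] [Preadditive C] [HasShift C ℤ]
  [∀ n : ℤ, (shiftFunctor C n).Additive] [Pretriangulated C]

/-- The smallest subclass of the heart containing `N` and closed under the rule:
if `A`, `C` and the middle homology `Ker g/Im f` of a complex `A —f→ B —g→ C`
(with `f` monic, `g` epic) belong to the class, then so does `B`. -/
inductive GenClass (t : TStructure C) [CategoryWithHomology (THeart C t)]
    (N : Set (THeart C t)) : THeart C t → Prop
  | base {X : THeart C t} (hX : X ∈ N) : GenClass t N X
  | ext {A B Z : THeart C t} (f : A ⟶ B) (g : B ⟶ Z) (w : f ≫ g = 0)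
      (hf : Mono f) (hg : Epi g) (hA : GenClass t N A) (hZ : GenClass t N Z)
      (hH : GenClass t N (ShortComplex.mk f g w).homology) : GenClass t N B

section Helpers

variable {C}

/-- Exactness at the shifted middle object. -/
lemma coyoneda_shift {T : Triangle C} (hT : T ∈ distTriang C) {X : C}
    (y : X ⟶ T.obj₂⟦(1 : ℤ)⟧) (hy : y ≫ T.mor₂⟦(1 : ℤ)⟧' = 0) :
    ∃ z : X ⟶ T.obj₁⟦(1 : ℤ)⟧, y = z ≫ T.mor₁⟦(1 : ℤ)⟧' := by
  obtain ⟨z, hz'⟩ : ∃ z : X ⟶ T.obj₁⟦(1 : ℤ)⟧, y = z ≫ (-T.mor₁⟦(1 : ℤ)⟧') :=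
    Triangle.coyoneda_exact₁ T.rotate (rot_of_distTriang _ hT) y hy
  refine ⟨-z, ?_⟩
  rw [hz', Preadditive.comp_neg]
  exact (Preadditive.neg_comp _ _).symm

/-- The four-lemma computation replacing the 3x3 lemma: if `Hom(X, -)` vanishes on the third
vertices over `A` and `D`, it vanishes on the third vertex over `B`. -/
lemma hom_zero_of_ext {T U TA TD TB : Triangle C}
    (hT : T ∈ distTriang C) (hU : U ∈ distTriang C)
    (hA : TA ∈ distTriang C) (hD : TD ∈ distTriang C) (hB : TB ∈ distTriang C)
    {A B D WA WB WD EA ED E : C} {f : A ⟶ B} {g : B ⟶ D} {h : D ⟶ A⟦(1 : ℤ)⟧}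
    {p : WA ⟶ WB} {q : WB ⟶ WD} {k : WD ⟶ WA⟦(1 : ℤ)⟧}
    {a : WA ⟶ A} {a' : A ⟶ EA} {a'' : EA ⟶ WA⟦(1 : ℤ)⟧}
    {d : WD ⟶ D} {d' : D ⟶ ED} {d'' : ED ⟶ WD⟦(1 : ℤ)⟧}
    {b : WB ⟶ B} {b' : B ⟶ E} {b'' : E ⟶ WB⟦(1 : ℤ)⟧}
    (eT : T = Triangle.mk f g h) (eU : U = Triangle.mk p q k)
    (eA : TA = Triangle.mk a a' a'') (eD : TD = Triangle.mk d d' d'')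
    (eB : TB = Triangle.mk b b' b'')
    (c₁ : p ≫ b = a ≫ f) (c₂ : q ≫ d = b ≫ g) (c₃ : k ≫ a⟦(1 : ℤ)⟧' = d ≫ h)
    {X : C} (zA : ∀ x : X ⟶ EA, x = 0) (zD : ∀ x : X ⟶ ED, x = 0) (e : X ⟶ E) : e = 0 := by
  subst eT eU eA eD eB
  -- injectivity on `W[1]`
  have injA : ∀ z : X ⟶ WA⟦(1 : ℤ)⟧, z ≫ a⟦(1 : ℤ)⟧' = 0 → z = 0 := by
    intro z hz
    obtain ⟨x, hx⟩ : ∃ x : X ⟶ EA, z = x ≫ a'' := Triangle.coyoneda_exact₁ _ hA z hz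
    rw [hx, zA x, zero_comp]
  have injD : ∀ z : X ⟶ WD⟦(1 : ℤ)⟧, z ≫ d⟦(1 : ℤ)⟧' = 0 → z = 0 := by
    intro z hz
    obtain ⟨x, hx⟩ : ∃ x : X ⟶ ED, z = x ≫ d'' := Triangle.coyoneda_exact₁ _ hD z hz
    rw [hx, zD x, zero_comp]
  have surA : ∀ z : X ⟶ A, ∃ z' : X ⟶ WA, z = z' ≫ a := fun z =>
    Triangle.coyoneda_exact₂ _ hA z (zA _)
  have surD : ∀ z : X ⟶ D, ∃ z' : X ⟶ WD, z = z' ≫ d := fun z =>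
    Triangle.coyoneda_exact₂ _ hD z (zD _)
  have hgh : g ≫ h = 0 := comp_distTriang_mor_zero₂₃ _ hT
  have hkp : k ≫ p⟦(1 : ℤ)⟧' = 0 := comp_distTriang_mor_zero₃₁ _ hU
  have hbb : b ≫ b' = 0 := comp_distTriang_mor_zero₁₂ _ hB
  have hbb2 : b'' ≫ b⟦(1 : ℤ)⟧' = 0 := comp_distTriang_mor_zero₃₁ _ hB
  have c₁' : p⟦(1 : ℤ)⟧' ≫ b⟦(1 : ℤ)⟧' = a⟦(1 : ℤ)⟧' ≫ f⟦(1 : ℤ)⟧' := by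
    rw [← Functor.map_comp, ← Functor.map_comp, c₁]
  have c₂' : q⟦(1 : ℤ)⟧' ≫ d⟦(1 : ℤ)⟧' = b⟦(1 : ℤ)⟧' ≫ g⟦(1 : ℤ)⟧' := by
    rw [← Functor.map_comp, ← Functor.map_comp, c₂]
  have injB : ∀ y : X ⟶ WB⟦(1 : ℤ)⟧, y ≫ b⟦(1 : ℤ)⟧' = 0 → y = 0 := by
    intro y hy
    have h1 : y ≫ q⟦(1 : ℤ)⟧' = 0 := injD _ (by
      rw [Category.assoc, c₂', ← Category.assoc, hy, zero_comp])
    obtain ⟨z, hz⟩ : ∃ z : X ⟶ WA⟦(1 : ℤ)⟧, y = z ≫ p⟦(1 : ℤ)⟧' := coyoneda_shift hU y h1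
    obtain ⟨u, hu⟩ : ∃ u : X ⟶ D, z ≫ a⟦(1 : ℤ)⟧' = u ≫ h :=
      Triangle.coyoneda_exact₁ _ hT (z ≫ a⟦(1 : ℤ)⟧') (by
        change (z ≫ a⟦(1 : ℤ)⟧') ≫ f⟦(1 : ℤ)⟧' = 0
        rw [Category.assoc, ← c₁', ← Category.assoc, ← hz, hy])
    obtain ⟨u', hu'⟩ := surD u
    have h2 : z - u' ≫ k = 0 := injA _ (by
      rw [Preadditive.sub_comp, Category.assoc, c₃, hu, hu', Category.assoc, sub_self])
    rw [hz, sub_eq_zero.1 h2, Category.assoc, hkp, comp_zero]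
  have h3 : e ≫ b'' = 0 := injB _ (by rw [Category.assoc, hbb2, comp_zero])
  obtain ⟨x, hx⟩ : ∃ x : X ⟶ B, e = x ≫ b' := Triangle.coyoneda_exact₃ _ hB e h3
  obtain ⟨y, hy⟩ := surD (x ≫ g)
  have h4 : y ≫ k = 0 := injA _ (by
    rw [Category.assoc, c₃, ← Category.assoc, ← hy, Category.assoc, hgh, comp_zero])
  obtain ⟨x', hx'⟩ : ∃ x' : X ⟶ WB, y = x' ≫ q := Triangle.coyoneda_exact₃ _ hU y h4
  obtain ⟨s, hs⟩ : ∃ s : X ⟶ A, x - x' ≫ b = s ≫ f :=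
    Triangle.coyoneda_exact₂ _ hT (x - x' ≫ b) (by
      change (x - x' ≫ b) ≫ g = 0
      rw [Preadditive.sub_comp, Category.assoc, ← c₂, hy, hx', Category.assoc, sub_self])
  obtain ⟨s', hs'⟩ := surA s
  have h5 : x = (x' + s' ≫ p) ≫ b := by
    rw [Preadditive.add_comp, Category.assoc, c₁, ← Category.assoc s', ← hs', ← hs]
    abel
  rw [hx, h5, Category.assoc, hbb, comp_zero]

section Weight

variable {le ge : Set C}

lemma ge_iso (hw : IsWeightStructure C le ge) {X Y : C} (i : X ≅ Y) (h : X ∈ ge) : Y ∈ ge :=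
  hw.retract_ge i.inv i.hom i.inv_hom_id h

lemma le_iso (hw : IsWeightStructure C le ge) {X Y : C} (i : X ≅ Y) (h : X ∈ le) : Y ∈ le :=
  hw.retract_le i.inv i.hom i.inv_hom_id h

lemma w_orth (hw : IsWeightStructure C le ge) {m : ℤ} {X Y : C} (hX : X ∈ shiftedClass C le m)
    (hY : Y ∈ shiftedClass C ge (m + 1)) (f : X ⟶ Y) : f = 0 := by
  apply (shiftFunctor C (-m)).map_injective
  rw [Functor.map_zero]
  let i : Y⟦(-(m + 1))⟧⟦(1 : ℤ)⟧ ≅ Y⟦(-m)⟧ :=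
    ((shiftFunctorAdd' C (-(m + 1)) 1 (-m) (by lia)).app Y).symm
  have := hw.orthogonal (X := X⟦(-m)⟧) hX hY (f⟦(-m)⟧' ≫ i.inv)
  rw [← cancel_mono i.inv, this, zero_comp]

lemma w_le_of_orth (hw : IsWeightStructure C le ge) {m : ℤ} {X : C}
    (hX : ∀ Y ∈ shiftedClass C ge (m + 1), ∀ f : X ⟶ Y, f = 0) :
    X ∈ shiftedClass C le m := by
  obtain ⟨B, A, f, g, h, hB, hA, hT⟩ := hw.exists_decomp (X⟦(-m)⟧)
  have hAm : A⟦m⟧ ∈ shiftedClass C ge (m + 1) :=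
    ge_iso hw ((shiftFunctorAdd' C m (-(m + 1)) (-1) (by lia)).app A) hA
  have hg : g = 0 := by
    apply (shiftFunctor C m).map_injective
    let i : X⟦(-m)⟧⟦m⟧ ≅ X := (shiftFunctorCompIsoId C (-m) m (by lia)).app X
    rw [Functor.map_zero, ← cancel_epi i.inv, comp_zero]
    exact hX _ hAm _
  obtain ⟨s, hs⟩ : ∃ s : X⟦(-m)⟧ ⟶ B, 𝟙 _ = s ≫ f :=
    Triangle.coyoneda_exact₂ _ hT (𝟙 _) (by change 𝟙 _ ≫ g = 0; rw [hg, comp_zero])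
  exact hw.retract_le s f hs.symm hB

lemma w_ge_of_orth (hw : IsWeightStructure C le ge) {m : ℤ} {E : C}
    (hE : ∀ X ∈ shiftedClass C le m, ∀ f : X ⟶ E, f = 0) :
    E ∈ shiftedClass C ge (m + 1) := by
  obtain ⟨B, A, f, g, h, hB, hA, hT⟩ := hw.exists_decomp (E⟦(-m)⟧)
  have hBm : B⟦m⟧ ∈ shiftedClass C le m :=
    le_iso hw ((shiftFunctorCompIsoId C m (-m) (by lia)).app B).symm hB
  have hf : f = 0 := by
    apply (shiftFunctor C m).map_injective
    let i : E⟦(-m)⟧⟦m⟧ ≅ E := (shiftFunctorCompIsoId C (-m) m (by lia)).app E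
    rw [Functor.map_zero, ← cancel_mono i.hom, zero_comp]
    exact hE _ hBm _
  obtain ⟨s, hs⟩ : ∃ s : A ⟶ E⟦(-m)⟧, 𝟙 _ = g ≫ s :=
    Triangle.yoneda_exact₂ _ hT (𝟙 _) (by change f ≫ 𝟙 _ = 0; rw [hf, zero_comp])
  have h1 : E⟦(-m)⟧⟦(-1 : ℤ)⟧ ∈ ge :=
    hw.retract_ge (g⟦(-1 : ℤ)⟧') (s⟦(-1 : ℤ)⟧')
      (by rw [← Functor.map_comp, ← hs, CategoryTheory.Functor.map_id]) hA
  exact ge_iso hw ((shiftFunctorAdd' C (-m) (-1) (-(m + 1)) (by lia)).app E).symm h1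

lemma nice_ext (hw : IsWeightStructure C le ge) (t : TStructure C) (m : ℤ)
    {A B D : C} {f : A ⟶ B} {g : B ⟶ D}
    {h : D ⟶ A⟦(1 : ℤ)⟧} (hT : Triangle.mk f g h ∈ distTriang C)
    (nA : NiceDecomp C le ge t m A) (nD : NiceDecomp C le ge t m D) :
    NiceDecomp C le ge t m B := by
  obtain ⟨WA, EA, a, a', a'', hA, wA, eA, ⟨tA1, tA2⟩, ⟨sA1, sA2⟩⟩ := nA
  obtain ⟨WD, ED, d, d', d'', hD, wD, eD, ⟨tD1, tD2⟩, ⟨sD1, sD2⟩⟩ := nD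
  rw [TStructure.le_iff_isLE] at tA1 tD1 sA1 sD1
  rw [TStructure.ge_iff_isGE] at tA2 tD2 sA2 sD2
  have eA1 : EA⟦(1 : ℤ)⟧ ∈ shiftedClass C ge (m + 1) :=
    ge_iso hw ((shiftFunctorComm C (-(m + 1)) 1).app EA) (hw.shift_ge eA)
  obtain ⟨k, hk⟩ : ∃ k : WD ⟶ WA⟦(1 : ℤ)⟧, d ≫ h = k ≫ a⟦(1 : ℤ)⟧' :=
    coyoneda_shift hA (d ≫ h) (w_orth hw wD eA1 _)
  obtain ⟨WB, p, q, hU⟩ := distinguished_cocone_triangle₂ k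
  obtain ⟨b, hb1, hb2⟩ := complete_distinguished_triangle_morphism₂ _ _ hU hT a d hk.symm
  change WB ⟶ B at b
  change p ≫ b = a ≫ f at hb1
  change q ≫ d = b ≫ g at hb2
  obtain ⟨E, b', b'', hB⟩ := distinguished_cocone_triangle b
  have key : ∀ X : C, (∀ x : X ⟶ EA, x = 0) → (∀ x : X ⟶ ED, x = 0) → ∀ e : X ⟶ E, e = 0 :=
    fun X zA zD e => hom_zero_of_ext hT hU hA hD hB rfl rfl rfl rfl rfl hb1 hb2 hk.symm zA zD e
  have lA : t.IsLE A 0 := t.isLE₂ _ hA 0 tA1 sA1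
  have lD : t.IsLE D 0 := t.isLE₂ _ hD 0 tD1 sD1
  have lB : t.IsLE B 0 := t.isLE₂ _ hT 0 lA lD
  have lW : t.IsLE WB 0 := t.isLE₂ _ hU 0 tA1 tD1
  have gW : t.IsGE WB 0 := t.isGE₂ _ hU 0 tA2 tD2
  have lW1 : t.IsLE (WB⟦(1 : ℤ)⟧) (-1) := t.isLE_shift WB 0 1 (-1)
  have lW2 : t.IsLE (WB⟦(1 : ℤ)⟧) 0 := t.isLE_of_le _ (-1) 0
  have lE : t.IsLE E 0 := t.isLE₂ _ (rot_of_distTriang _ hB) 0 lB lW2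
  have gE : t.IsGE E 0 := by
    rw [t.isGE_iff_orthogonal (-1) 0 (by lia)]
    intro Y e hY
    exact key Y (fun x => t.zero x (-1) 0) (fun x => t.zero x (-1) 0) e
  refine ⟨WB, E, b, b', b'', hB, ?_, ?_, ⟨lW.le, gW.ge⟩, ⟨lE.le, gE.ge⟩⟩
  · refine w_le_of_orth hw (fun Y hY x => ?_)
    obtain ⟨y, hy⟩ : ∃ y : WD ⟶ Y, x = q ≫ y :=
      Triangle.yoneda_exact₂ _ hU x (w_orth hw wA hY _)
    rw [hy, w_orth hw wD hY y, comp_zero]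
  · exact w_ge_of_orth hw (fun X hX x =>
      key X (fun y => w_orth hw hX eA y) (fun y => w_orth hw hX eD y) x)

end Weight

lemma nice_iso {le ge : Set C} {t : TStructure C} {m : ℤ} {X Y : C} (i : X ≅ Y)
    (h : NiceDecomp C le ge t m X) : NiceDecomp C le ge t m Y := by
  obtain ⟨W, E, f, g, k, hT, h⟩ := h
  refine ⟨W, E, f ≫ i.hom, i.inv ≫ g, k, ?_, h⟩
  refine isomorphic_distinguished _ hT _ ?_
  refine Triangle.isoMk _ _ (Iso.refl _) i.symm (Iso.refl _) ?_ ?_ ?_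
  · change (f ≫ i.hom) ≫ i.inv = 𝟙 W ≫ f
    simp
  · change (i.inv ≫ g) ≫ 𝟙 E = i.inv ≫ g
    simp
  · change k ≫ (𝟙 W)⟦(1 : ℤ)⟧' = 𝟙 E ≫ k
    simp

/-- The cone of a monomorphism of the heart is in the heart. -/
lemma heart_cone (t : TStructure C) {A B S : C} {f : A ⟶ B} {g : B ⟶ S}
    {h : S ⟶ A⟦(1 : ℤ)⟧} (hT : Triangle.mk f g h ∈ distTriang C)
    (hA : A ∈ heartSet C t) (hB : B ∈ heartSet C t)
    (hf : ∀ Y ∈ heartSet C t, ∀ u : Y ⟶ A, u ≫ f = 0 → u = 0) : S ∈ heartSet C t := by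
  have lA : t.IsLE A 0 := ⟨hA.1⟩
  have gA : t.IsGE A 0 := ⟨hA.2⟩
  have lB : t.IsLE B 0 := ⟨hB.1⟩
  have gB : t.IsGE B 0 := ⟨hB.2⟩
  have lA1 : t.IsLE (A⟦(1 : ℤ)⟧) (-1) := t.isLE_shift A 0 1 (-1)
  have lA2 : t.IsLE (A⟦(1 : ℤ)⟧) 0 := t.isLE_of_le _ (-1) 0
  have gA1 : t.IsGE (A⟦(1 : ℤ)⟧) (-1) := t.isGE_shift A 0 1 (-1)
  have gB1 : t.IsGE B (-1) := t.isGE_of_ge _ (-1) 0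
  have lS : t.IsLE S 0 := t.isLE₂ _ (rot_of_distTriang _ hT) 0 lB lA2
  have gS : t.IsGE S (-1) := t.isGE₂ _ (rot_of_distTriang _ hT) (-1) gB1 gA1
  refine ⟨lS.le, ?_⟩
  rw [TStructure.ge_iff_isGE, t.isGE_iff_orthogonal (-1) 0 (by lia)]
  obtain ⟨K, S', hK, hS', i, j, l, hK'⟩ := t.exists_triangle S (-1) 0 (by lia)
  have lK : t.IsLE K (-1) := ⟨hK⟩
  have gS' : t.IsGE S' 0 := ⟨hS'⟩
  have gS'' : t.IsGE (S'⟦(-1 : ℤ)⟧) 1 := t.isGE_shift S' 0 (-1) 1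
  have gS''' : t.IsGE (S'⟦(-1 : ℤ)⟧) (-1) := t.isGE_of_ge _ (-1) 1
  have gK : t.IsGE K (-1) := t.isGE₂ _ (inv_rot_of_distTriang _ hK') (-1) gS''' gS
  have lK0 : t.IsLE (K⟦(-1 : ℤ)⟧) 0 := t.isLE_shift K (-1) (-1) 0
  have gK0 : t.IsGE (K⟦(-1 : ℤ)⟧) 0 := t.isGE_shift K (-1) (-1) 0
  let e : K⟦(-1 : ℤ)⟧⟦(1 : ℤ)⟧ ≅ K := (shiftFunctorCompIsoId C (-1) 1 (by lia)).app K
  let u : K⟦(-1 : ℤ)⟧ ⟶ A := (shiftFunctor C (1 : ℤ)).preimage (e.hom ≫ i ≫ h)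
  have hu : u⟦(1 : ℤ)⟧' = e.hom ≫ i ≫ h := Functor.map_preimage _ _
  have hhf : h ≫ f⟦(1 : ℤ)⟧' = 0 := comp_distTriang_mor_zero₃₁ _ hT
  have hu0 : u = 0 := hf _ ⟨lK0.le, gK0.ge⟩ u (by
    apply (shiftFunctor C (1 : ℤ)).map_injective
    rw [Functor.map_comp, hu, Functor.map_zero, Category.assoc, Category.assoc, hhf,
      comp_zero, comp_zero])
  have hih : i ≫ h = 0 := by
    rw [← cancel_epi e.hom, ← hu, hu0, Functor.map_zero, comp_zero]
  obtain ⟨r, hr⟩ : ∃ r : K ⟶ B, i = r ≫ g := Triangle.coyoneda_exact₃ _ hT i hih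
  have hi : i = 0 := by rw [hr, t.zero r (-1) 0, zero_comp]
  intro Y x hY
  obtain ⟨y, hy⟩ : ∃ y : Y ⟶ K, x = y ≫ i :=
    Triangle.coyoneda_exact₂ _ hK' x (t.zero_of_isLE_of_isGE _ (-1) 0 (by lia) hY gS')
  rw [hy, hi, comp_zero]

/-- The fiber of an epimorphism of the heart is in the heart. -/
lemma heart_fiber (t : TStructure C) {F B Z : C} {f : F ⟶ B} {g : B ⟶ Z}
    {h : Z ⟶ F⟦(1 : ℤ)⟧} (hT : Triangle.mk f g h ∈ distTriang C)
    (hB : B ∈ heartSet C t) (hZ : Z ∈ heartSet C t)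
    (hg : ∀ Y ∈ heartSet C t, ∀ u : Z ⟶ Y, g ≫ u = 0 → u = 0) : F ∈ heartSet C t := by
  have lZ : t.IsLE Z 0 := ⟨hZ.1⟩
  have gZ : t.IsGE Z 0 := ⟨hZ.2⟩
  have lB : t.IsLE B 0 := ⟨hB.1⟩
  have gB : t.IsGE B 0 := ⟨hB.2⟩
  have lB1 : t.IsLE (B⟦(1 : ℤ)⟧) (-1) := t.isLE_shift B 0 1 (-1)
  have lB2 : t.IsLE (B⟦(1 : ℤ)⟧) 0 := t.isLE_of_le _ (-1) 0
  have gZ1 : t.IsGE (Z⟦(-1 : ℤ)⟧) 1 := t.isGE_shift Z 0 (-1) 1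
  have gZ2 : t.IsGE (Z⟦(-1 : ℤ)⟧) 0 := t.isGE_of_ge _ 0 1
  have gF : t.IsGE F 0 := t.isGE₂ _ (inv_rot_of_distTriang _ hT) 0 gZ2 gB
  have lS : t.IsLE (F⟦(1 : ℤ)⟧) 0 :=
    t.isLE₂ _ (rot_of_distTriang _ (rot_of_distTriang _ hT)) 0 lZ lB2
  refine ⟨?_, gF.ge⟩
  have lS1 : t.IsLE (F⟦(1 : ℤ)⟧) (-1) := by
    rw [t.isLE_iff_orthogonal (-1) 0 (by lia)]
    obtain ⟨K, S', hK, hS', i, j, l, hK'⟩ := t.exists_triangle (F⟦(1 : ℤ)⟧) (-1) 0 (by lia)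
    have lK : t.IsLE K (-1) := ⟨hK⟩
    have gS' : t.IsGE S' 0 := ⟨hS'⟩
    have lK1 : t.IsLE (K⟦(1 : ℤ)⟧) (-2) := t.isLE_shift K (-1) 1 (-2)
    have lK2 : t.IsLE (K⟦(1 : ℤ)⟧) 0 := t.isLE_of_le _ (-2) 0
    have lS' : t.IsLE S' 0 := t.isLE₂ _ (rot_of_distTriang _ hK') 0 lS lK2
    have hgh : g ≫ h = 0 := comp_distTriang_mor_zero₂₃ _ hT
    have hhj : h ≫ j = 0 := hg S' ⟨lS'.le, gS'.ge⟩ (h ≫ j) (by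
      rw [← Category.assoc, hgh, zero_comp])
    obtain ⟨r, hr⟩ : ∃ r : B⟦(1 : ℤ)⟧ ⟶ S', j = (-f⟦(1 : ℤ)⟧') ≫ r :=
      Triangle.yoneda_exact₃ _ (rot_of_distTriang _ hT) j hhj
    have hj : j = 0 := by rw [hr, t.zero r (-1) 0, comp_zero]
    intro Y x hY
    obtain ⟨y, hy⟩ : ∃ y : S' ⟶ Y, x = j ≫ y :=
      Triangle.yoneda_exact₂ _ hK' x (t.zero_of_isLE_of_isGE _ (-1) 0 (by lia) lK hY)
    rw [hy, hj, zero_comp]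
  exact (t.isLE_of_shift F 0 1 (-1)).le

/-- The fiber of an epimorphism of the heart is its kernel. -/
noncomputable def heartKernel (t : TStructure C) {F B Z : THeart C t} (i : F ⟶ B) (g : B ⟶ Z)
    {h : Z.obj ⟶ F.obj⟦(1 : ℤ)⟧} (hT : Triangle.mk i.hom g.hom h ∈ distTriang C)
    (wi : i ≫ g = 0) : IsLimit (KernelFork.ofι i wi) := by
  have gZ : t.IsGE Z.obj 0 := ⟨Z.property.2⟩
  have gZ1 : t.IsGE (Z.obj⟦(-1 : ℤ)⟧) 1 := t.isGE_shift Z.obj 0 (-1) 1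
  have ex : ∀ {Y : THeart C t} (x : Y ⟶ B), x ≫ g = 0 → ∃ y : Y ⟶ F, y ≫ i = x := by
    intro Y x hx
    obtain ⟨y, hy⟩ : ∃ y : Y.obj ⟶ F.obj, x.hom = y ≫ i.hom :=
      Triangle.coyoneda_exact₂ _ hT x.hom (congrArg (fun z => z.hom) hx)
    exact ⟨ObjectProperty.homMk y, ObjectProperty.hom_ext _ hy.symm⟩
  have mono : Mono i := by
    refine Preadditive.mono_of_cancel_zero _ (fun {Y} x hx => ?_)
    have lY : t.IsLE Y.obj 0 := ⟨Y.property.1⟩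
    obtain ⟨v, hv⟩ : ∃ v : Z.obj⟦(-1 : ℤ)⟧ ⟶ F.obj,
        v = (Triangle.mk i.hom g.hom h).invRotate.mor₁ := ⟨_, rfl⟩
    obtain ⟨y, hy⟩ : ∃ y : Y.obj ⟶ Z.obj⟦(-1 : ℤ)⟧, x.hom = y ≫ v := hv ▸
      Triangle.coyoneda_exact₂ _ (inv_rot_of_distTriang _ hT) x.hom
        (congrArg (fun z => z.hom) hx)
    apply ObjectProperty.hom_ext
    rw [hy, t.zero y 0 1, zero_comp]
    rfl
  exact KernelFork.IsLimit.ofι' i wi (fun x hx => ⟨(ex x hx).choose, (ex x hx).choose_spec⟩)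

/-- The cone of a monomorphism of the heart is its cokernel. -/
noncomputable def heartCokernel (t : TStructure C) {A F H : THeart C t} (j : A ⟶ F) (p : F ⟶ H)
    {h : H.obj ⟶ A.obj⟦(1 : ℤ)⟧} (hT : Triangle.mk j.hom p.hom h ∈ distTriang C)
    (wp : j ≫ p = 0) : IsColimit (CokernelCofork.ofπ p wp) := by
  have lA : t.IsLE A.obj 0 := ⟨A.property.1⟩
  have lA1 : t.IsLE (A.obj⟦(1 : ℤ)⟧) (-1) := t.isLE_shift A.obj 0 1 (-1)
  have ex : ∀ {Y : THeart C t} (x : F ⟶ Y), j ≫ x = 0 → ∃ y : H ⟶ Y, p ≫ y = x := by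
    intro Y x hx
    obtain ⟨y, hy⟩ : ∃ y : H.obj ⟶ Y.obj, x.hom = p.hom ≫ y :=
      Triangle.yoneda_exact₂ _ hT x.hom (congrArg (fun z => z.hom) hx)
    exact ⟨ObjectProperty.homMk y, ObjectProperty.hom_ext _ hy.symm⟩
  have epi : Epi p := by
    refine Preadditive.epi_of_cancel_zero _ (fun {Y} x hx => ?_)
    have gY : t.IsGE Y.obj 0 := ⟨Y.property.2⟩
    obtain ⟨y, hy⟩ : ∃ y : A.obj⟦(1 : ℤ)⟧ ⟶ Y.obj, x.hom = h ≫ y :=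
      Triangle.yoneda_exact₃ _ hT x.hom (congrArg (fun z => z.hom) hx)
    apply ObjectProperty.hom_ext
    rw [hy, t.zero y (-1) 0, comp_zero]
    rfl
  exact CokernelCofork.IsColimit.ofπ' p wp
    (fun x hx => ⟨(ex x hx).choose, (ex x hx).choose_spec⟩)

lemma nice_middle {le ge : Set C} (hw : IsWeightStructure C le ge)
    (t : TStructure C) [CategoryWithHomology (THeart C t)] (m : ℤ)
    {A B Z : THeart C t} (f : A ⟶ B) (g : B ⟶ Z) (w : f ≫ g = 0) (hf : Mono f) (hg : Epi g)
    (nA : NiceDecomp C le ge t m A.obj) (nZ : NiceDecomp C le ge t m Z.obj)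
    (nH : NiceDecomp C le ge t m (ShortComplex.mk f g w).homology.obj) :
    NiceDecomp C le ge t m B.obj := by
  obtain ⟨F', i', h, hT⟩ := distinguished_cocone_triangle₁ g.hom
  have hF' : F' ∈ heartSet C t := heart_fiber t hT B.property Z.property (by
    intro Y hY u hu
    have h0 : (ObjectProperty.homMk u : Z ⟶ ⟨Y, hY⟩) = 0 := by
      rw [← cancel_epi g, comp_zero]
      exact ObjectProperty.hom_ext _ hu
    exact congrArg (fun z => z.hom) h0)
  let F : THeart C t := ⟨F', hF'⟩
  let i : F ⟶ B := ObjectProperty.homMk i'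
  have wi : i ≫ g = 0 := ObjectProperty.hom_ext _ (comp_distTriang_mor_zero₁₂ _ hT)
  let hi : IsLimit (KernelFork.ofι i wi) := heartKernel t i g hT wi
  let j : A ⟶ F := hi.lift (KernelFork.ofι f w)
  have hji : j ≫ i = f := hi.fac (KernelFork.ofι f w) WalkingParallelPair.zero
  obtain ⟨H', p', h', hT'⟩ := distinguished_cocone_triangle j.hom
  have hH' : H' ∈ heartSet C t := heart_cone t hT' A.property F.property (by
    intro Y hY u hu
    have h0 : (ObjectProperty.homMk u : (⟨Y, hY⟩ : THeart C t) ⟶ A) = 0 := by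
      rw [← cancel_mono f, zero_comp, ← hji, ← Category.assoc]
      have : (ObjectProperty.homMk u : (⟨Y, hY⟩ : THeart C t) ⟶ A) ≫ j = 0 :=
        ObjectProperty.hom_ext _ hu
      rw [this, zero_comp]
    exact congrArg (fun z => z.hom) h0)
  let H : THeart C t := ⟨H', hH'⟩
  let p : F ⟶ H := ObjectProperty.homMk p'
  have wp : j ≫ p = 0 := ObjectProperty.hom_ext _ (comp_distTriang_mor_zero₁₂ _ hT')
  let L : (ShortComplex.mk f g w).LeftHomologyData :=
    { K := F, H := H, i := i, π := p, wi := wi, hi := hi, wπ := wp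
      hπ := heartCokernel t j p hT' wp }
  have nH' : NiceDecomp C le ge t m H.obj :=
    nice_iso ((heartIncl C t).mapIso L.homologyIso) nH
  exact nice_ext hw t m hT (nice_ext hw t m hT' nA nH') nZ

end Helpers

/-- If every object of `N ⊆ C^{t=0}` admits a nice decomposition
for `m`, then so does every object of the smallest class `N'` containing `N` and
closed under the middle-term homology rule above. -/
theorem statement6 (le ge : Set C) (hw : IsWeightStructure C le ge)
    (t : TStructure C) [CategoryWithHomology (THeart C t)] (m : ℤ)
    (N : Set (THeart C t)) (hN : ∀ X ∈ N, NiceDecomp C le ge t m X.obj) :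
    ∀ X : THeart C t, GenClass C t N X → NiceDecomp C le ge t m X.obj := by
  intro X hX
  induction hX with
  | base h => exact hN _ h
  | ext f g w hf hg _ _ _ ihA ihZ ihH => exact nice_middle hw t m f g w hf hg ihA ihZ ihH

end PaperWeights
end

section
/- Let t be a bounded t-structure transversal to a bounded weight structure w on a triangulated category C, and let m ∈ ℤ. Then nice decompositions (for m) exist for all X ∈ C^{t=0} and are Ht-functorial in X: there is a functor W_{≤m} : Ht → Ht together with a natural transformation ι : W_{≤m} → Id_{Ht} such that for every X ∈ C^{t=0} the morphism ι_X : W_{≤m}X → X is the first morphism of a nice decomposition of X for m; moreover, W_{≤m}X is canonically isomorphic to W_m H^t_0(X) = Im(H^t_0(w_{≤m}X) → H^t_0(X)) for any choice of weight decomposition w_{≤m}X → X → w_{≥m+1}X. -/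
namespace PaperWeights

open CategoryTheory CategoryTheory.Limits CategoryTheory.Pretriangulated CategoryTheory.Triangulated

universe v u

variable (C : Type u) [Category.{v} C] [HasZeroObject C] [Preadditive C] [HasShift C ℤ]
  [∀ n : ℤ, (shiftFunctor C n).Additive] [Pretriangulated C]

/-- Truncation data for a t-structure `t`: functors `τ_{≤0}`, `τ_{≥0}` with the
usual universal properties (such data always exists for a t-structure), together
with the zeroth homology functor data and the canonical identification of
`H^t_0` with the identity on the heart. -/
structure TruncData (t : TStructure C) where
  truncLE : C ⥤ C
  truncGE : C ⥤ C
  /-- the canonical map `τ_{≤0}X ⟶ X` -/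
  εLE : truncLE ⟶ 𝟭 C
  /-- the canonical map `X ⟶ τ_{≥0}X` -/
  ηGE : 𝟭 C ⟶ truncGE
  mem_le : ∀ X : C, t.le 0 (truncLE.obj X)
  mem_ge : ∀ X : C, t.ge 0 (truncGE.obj X)
  le_univ : ∀ (W X : C), t.le 0 W →
    Function.Bijective (fun f : W ⟶ truncLE.obj X => f ≫ εLE.app X)
  ge_univ : ∀ (X W : C), t.ge 0 W →
    Function.Bijective (fun f : truncGE.obj X ⟶ W => ηGE.app X ≫ f)
  mem_heart : ∀ X : C, truncGE.obj (truncLE.obj X) ∈ heartSet C t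
  /-- the canonical identification `H^t_0(X) ≅ X` for `X` in the heart -/
  isoHeart : ∀ X : C, X ∈ heartSet C t → (truncGE.obj (truncLE.obj X) ≅ X)

variable {C}

/-- The zeroth homology functor `H^t_0 : C ⥤ Ht` associated to truncation data. -/
def TruncData.H₀ {t : TStructure C} (τ : TruncData C t) : C ⥤ THeart C t :=
  ObjectProperty.lift _ (τ.truncLE ⋙ τ.truncGE) (fun X => τ.mem_heart X)

/-- The homology functors `H^t_i(X) = H^t_0(X⟦i⟧)`. -/
def TruncData.H {t : TStructure C} (τ : TruncData C t) (i : ℤ) : C ⥤ THeart C t :=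
  shiftFunctor C i ⋙ τ.H₀

/-- The identification `H^t_0(X) ≅ X` for `X` in the heart, as an isomorphism
in the heart. -/
def TruncData.heartIso {t : TStructure C} (τ : TruncData C t) (X : THeart C t) :
    τ.H₀.obj X.obj ≅ X where
  hom := ObjectProperty.homMk (τ.isoHeart X.obj X.property).hom
  inv := ObjectProperty.homMk (τ.isoHeart X.obj X.property).inv
  hom_inv_id := ObjectProperty.hom_ext _ (τ.isoHeart X.obj X.property).hom_inv_id
  inv_hom_id := ObjectProperty.hom_ext _ (τ.isoHeart X.obj X.property).inv_hom_id

variable (C)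
theorem orth_shifted {le ge : Set C} (hw : IsWeightStructure C le ge) (m : ℤ) {X Y : C}
    (hX : X ∈ shiftedClass C le m) (hY : Y ∈ shiftedClass C ge (m + 1)) (f : X ⟶ Y) : f = 0 := by
  apply (shiftFunctor C (-m)).map_injective
  let e := (shiftFunctorAdd' C (-(m+1)) 1 (-m) (by lia)).app Y
  have := hw.orthogonal hX hY ((shiftFunctor C (-m)).map f ≫ e.hom)
  rw [Functor.map_zero]
  rw [← cancel_mono e.hom, zero_comp]
  exact this

theorem mono_of_nice {t : TStructure C} {W X Q : C} {f : W ⟶ X} {g : X ⟶ Q} {h : Q ⟶ W⟦(1 : ℤ)⟧}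
    (hT : Triangle.mk f g h ∈ distTriang C) (hQ : t.ge 0 Q) {Z : C} (hZ : t.le 0 Z)
    (u : Z ⟶ W) (hu : u ≫ f = 0) : u = 0 := by
  obtain ⟨v, hv⟩ := Triangle.coyoneda_exact₂ _ (inv_rot_of_distTriang _ hT) u hu
  have : v = 0 := t.zero' v hZ (t.ge_shift 0 (-1) 1 (by lia) _ hQ)
  rw [hv, this, zero_comp]
  rfl

theorem mono_of_nice' {t : TStructure C} {W X Q : C} {f : W ⟶ X} {g : X ⟶ Q} {h : Q ⟶ W⟦(1 : ℤ)⟧}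
    (hT : Triangle.mk f g h ∈ distTriang C) (hQ : t.ge 0 Q) {Z : C} (hZ : t.le 0 Z)
    (u v : Z ⟶ W) (hu : u ≫ f = v ≫ f) : u = v := by
  rw [← sub_eq_zero]
  exact mono_of_nice C hT hQ hZ _ (by rw [Preadditive.sub_comp, hu, sub_self])

theorem lift_nice {le ge : Set C} (hw : IsWeightStructure C le ge) {m : ℤ} {W X Q : C}
    {f : W ⟶ X} {g : X ⟶ Q} {h : Q ⟶ W⟦(1 : ℤ)⟧}
    (hT : Triangle.mk f g h ∈ distTriang C) (hQ : Q ∈ shiftedClass C ge (m + 1)) {A : C}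
    (hA : A ∈ shiftedClass C le m) (u : A ⟶ X) : ∃ v : A ⟶ W, v ≫ f = u := by
  obtain ⟨v, hv⟩ := Triangle.coyoneda_exact₂ _ hT u (orth_shifted C hw m hA hQ _)
  exact ⟨v, hv.symm⟩

theorem isIso_eps {t : TStructure C} (τ : TruncData C t) {X : C} (hX : t.le 0 X) :
    IsIso (τ.εLE.app X) := by
  obtain ⟨s, hs⟩ := (τ.le_univ X X hX).2 (𝟙 X)
  refine ⟨s, ?_, hs⟩
  apply (τ.le_univ _ X (τ.mem_le X)).1
  have hs' : s ≫ τ.εLE.app X = 𝟙 X := hs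
  show (τ.εLE.app X ≫ s) ≫ τ.εLE.app X = 𝟙 _ ≫ τ.εLE.app X
  rw [Category.assoc, hs', Category.id_comp]
  exact Category.comp_id _

theorem isIso_eta {t : TStructure C} (τ : TruncData C t) {X : C} (hX : t.ge 0 X) :
    IsIso (τ.ηGE.app X) := by
  obtain ⟨s, hs⟩ := (τ.ge_univ X X hX).2 (𝟙 X)
  refine ⟨s, hs, ?_⟩
  apply (τ.ge_univ X _ (τ.mem_ge X)).1
  have hs' : τ.ηGE.app X ≫ s = 𝟙 X := hs
  show τ.ηGE.app X ≫ (s ≫ τ.ηGE.app X) = τ.ηGE.app X ≫ 𝟙 _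
  rw [reassoc_of% hs']
  exact (Category.comp_id _).symm

/-- `H₀ f` is a monomorphism if `f` is one in the heart. -/
theorem mono_H₀ {t : TStructure C} (τ : TruncData C t) {W X : THeart C t} (f : W ⟶ X) [Mono f] :
    Mono (τ.H₀.map f.hom) := by
  have key : ∀ Y : THeart C t, ∃ e : τ.truncLE.obj Y.obj ≅ Y.obj, e.hom = τ.εLE.app Y.obj := by
    intro Y
    have := isIso_eps C τ Y.property.1
    exact ⟨asIso (τ.εLE.app Y.obj), rfl⟩
  have key2 : ∀ Y : THeart C t, ∃ e : τ.truncLE.obj Y.obj ≅ (τ.H₀.obj Y.obj).obj,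
      e.hom = τ.ηGE.app (τ.truncLE.obj Y.obj) := by
    intro Y
    obtain ⟨e, -⟩ := key Y
    have := isIso_eta C τ ((t.ge 0).prop_of_iso e.symm Y.property.2)
    exact ⟨@asIso _ _ _ _ (τ.ηGE.app (τ.truncLE.obj Y.obj)) this, rfl⟩
  obtain ⟨eW, hW⟩ := key W
  obtain ⟨eX, hX⟩ := key X
  obtain ⟨dW, hdW⟩ := key2 W
  obtain ⟨dX, hdX⟩ := key2 X
  have n1 : τ.truncLE.map f.hom ≫ eX.hom = eW.hom ≫ f.hom := by
    rw [hX, hW]; exact τ.εLE.naturality f.hom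
  have n2 : dW.hom ≫ (τ.H₀.map f.hom).hom = τ.truncLE.map f.hom ≫ dX.hom := by
    rw [hdW, hdX]; exact (τ.ηGE.naturality (τ.truncLE.map f.hom)).symm
  have n3 : (τ.H₀.map f.hom).hom ≫ dX.inv ≫ eX.hom = (dW.inv ≫ eW.hom) ≫ f.hom := by
    rw [Category.assoc, ← n1, ← cancel_epi dW.hom, reassoc_of% n2]
    simp
  let iW : τ.H₀.obj W.obj ⟶ W := ObjectProperty.homMk (dW.inv ≫ eW.hom)
  let jW : W ⟶ τ.H₀.obj W.obj := ObjectProperty.homMk (eW.inv ≫ dW.hom)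
  let iX : τ.H₀.obj X.obj ⟶ X := ObjectProperty.homMk (dX.inv ≫ eX.hom)
  have n4 : τ.H₀.map f.hom ≫ iX = iW ≫ f := ObjectProperty.hom_ext _ n3
  have : iW ≫ jW = 𝟙 _ := ObjectProperty.hom_ext _ (by simp [iW, jW])
  have : Mono iW := mono_of_mono_fac this
  have : Mono (τ.H₀.map f.hom ≫ iX) := by rw [n4]; infer_instance
  exact mono_of_mono _ iX

/-- If bounded `t` is transversal to bounded `w`, then for each
`m` nice decompositions exist functorially on the heart: there is a functor
`W_{≤m} : Ht ⥤ Ht` with a natural transformation `ι : W_{≤m} ⟶ Id` whose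
components are the first morphisms of nice decompositions; moreover `W_{≤m}X` is
isomorphic to `W_m H^t_0(X) = Im (H^t_0(w_{≤m}X) → H^t_0(X))` for any choice of
weight decomposition of `X`. -/
theorem statement7 (le ge : Set C) (hw : IsWeightStructure C le ge)
    (hbw : WBounded C le ge) (t : TStructure C) (hbt : TBounded C t)
    (htr : Transversal C le ge t) (τ : TruncData C t)
    [HasImages (THeart C t)] (m : ℤ) :
    ∃ (Wm : THeart C t ⥤ THeart C t) (ι : Wm ⟶ 𝟭 (THeart C t)),
      (∀ X : THeart C t,
        ∃ (B : C) (g : X.obj ⟶ B) (h : B ⟶ ((Wm.obj X).obj)⟦(1 : ℤ)⟧),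
          (Triangle.mk ((heartIncl C t).map (ι.app X)) g h ∈ distTriang C) ∧
          (Wm.obj X).obj ∈ shiftedClass C le m ∧
          B ∈ shiftedClass C ge (m + 1) ∧ B ∈ heartSet C t) ∧
      (∀ (X : THeart C t) (A B : C) (f : A ⟶ X.obj) (g : X.obj ⟶ B)
          (h : B ⟶ A⟦(1 : ℤ)⟧),
          (Triangle.mk f g h ∈ distTriang C) → A ∈ shiftedClass C le m →
          B ∈ shiftedClass C ge (m + 1) →
          Nonempty (Wm.obj X ≅ image (τ.H₀.map f ≫ (τ.heartIso X).hom))) := by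
  choose W Q f g h hT hWle hQge hWh hQh using fun X : THeart C t => htr X.obj X.property m
  choose L hL using fun (X Y : THeart C t) (φ : X ⟶ Y) =>
    lift_nice C hw (hT Y) (hQge Y) (hWle X) (f X ≫ φ.hom)
  let Wm : THeart C t ⥤ THeart C t :=
    { obj := fun X => ⟨W X, hWh X⟩
      map := fun {X Y} φ => ObjectProperty.homMk (L X Y φ)
      map_id := fun X => ObjectProperty.hom_ext _
        (mono_of_nice' C (hT X) (hQh X).2 (hWh X).1 _ _ (by
          show L X X (𝟙 X) ≫ f X = 𝟙 _ ≫ f X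
          rw [hL, Category.id_comp]; exact Category.comp_id _))
      map_comp := fun {X Y Z} φ ψ => ObjectProperty.hom_ext _
        (mono_of_nice' C (hT Z) (hQh Z).2 (hWh X).1 _ _ (by
          show L X Z (φ ≫ ψ) ≫ f Z = (L X Y φ ≫ L Y Z ψ) ≫ f Z
          rw [hL, Category.assoc, hL, reassoc_of% (hL X Y φ)]; rfl)) }
  let ι : Wm ⟶ 𝟭 (THeart C t) :=
    { app := fun X => ObjectProperty.homMk (f X)
      naturality := fun X Y φ => ObjectProperty.hom_ext _ (hL X Y φ) }
  refine ⟨Wm, ι, fun X => ⟨Q X, g X, h X, hT X, hWle X, hQge X, hQh X⟩, ?_⟩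
  intro X A B p q r hT' hA hB
  obtain ⟨a, ha⟩ := lift_nice C hw (hT X) (hQge X) hA p
  obtain ⟨b, hb⟩ := lift_nice C hw hT' hB (hWle X) (f X)
  have hba : b ≫ a = 𝟙 (W X) :=
    mono_of_nice' C (hT X) (hQh X).2 (hWh X).1 _ _ (by
      rw [Category.assoc, ha, hb, Category.id_comp])
  have hmono : Mono (ι.app X) := ⟨fun {Z} u v huv => ObjectProperty.hom_ext _
    (mono_of_nice' C (hT X) (hQh X).2 Z.property.1 _ _ (congrArg (fun k => k.hom) huv))⟩
  have hm : Mono (τ.H₀.map (f X)) := mono_H₀ C τ (ι.app X)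
  have hs : IsSplitEpi (τ.H₀.map a) :=
    ⟨⟨⟨τ.H₀.map b, by rw [← Functor.map_comp, hba, CategoryTheory.Functor.map_id]⟩⟩⟩
  have hfac : τ.H₀.map a ≫ (τ.H₀.map (f X) ≫ (τ.heartIso X).hom) =
      τ.H₀.map p ≫ (τ.heartIso X).hom := by
    rw [← ha, Functor.map_comp, Category.assoc]
  let F : StrongEpiMonoFactorisation (τ.H₀.map p ≫ (τ.heartIso X).hom) :=
    { I := τ.H₀.obj (W X)
      m := τ.H₀.map (f X) ≫ (τ.heartIso X).hom
      m_mono := mono_comp _ _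
      e := τ.H₀.map a
      fac := hfac
      e_strong_epi := inferInstance }
  exact ⟨(τ.heartIso (Wm.obj X)).symm ≪≫ F.toMonoIsImage.isoExt (Image.isImage _)⟩

end PaperWeights
end

section
/- Let t be a bounded t-structure transversal to a bounded weight structure w on a triangulated category C. Then every X ∈ C^{t=0} admits an increasing filtration by subobjects W_{≤m}X (m ∈ ℤ) in the heart Ht, with W_{≤m}X = 0 for m sufficiently small and W_{≤m}X = X for m sufficiently large, whose m-th graded factor W_{≤m}X/W_{≤m−1}X belongs to A_m = C^{t=0} ∩ C_{w=m} for every m ∈ ℤ. Moreover, this filtration is uniquely determined by this condition and is functorial in X. -/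
namespace PaperWeights

open CategoryTheory CategoryTheory.Limits CategoryTheory.Pretriangulated CategoryTheory.Triangulated

universe v u

variable (C : Type u) [Category.{v} C] [HasZeroObject C] [Preadditive C] [HasShift C ℤ]
  [∀ n : ℤ, (shiftFunctor C n).Additive] [Pretriangulated C]

/-- An increasing filtration of an object `X` of the heart by subobjects `W m`,
exhaustive and separated, whose `m`-th graded factor lies in
`A_m = C^{t=0} ∩ C_{w=m}`. -/
structure HeartFilt (le ge : Set C) (t : TStructure C)
    [HasCokernels (THeart C t)] (X : THeart C t) where
  W : ℤ → THeart C t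
  ι : ∀ m : ℤ, W m ⟶ X
  σ : ∀ m : ℤ, W (m - 1) ⟶ W m
  mono : ∀ m : ℤ, Mono (ι m)
  compat : ∀ m : ℤ, σ m ≫ ι m = ι (m - 1)
  eventually_zero : ∃ a : ℤ, ∀ m ≤ a, IsZero (W m)
  eventually_all : ∃ b : ℤ, ∀ m : ℤ, b ≤ m → IsIso (ι m)
  graded : ∀ m : ℤ, (cokernel (σ m)).obj ∈ wEq C le ge m

section Helpers

variable {C}
variable {le ge : Set C}

lemma ge_of_iso (hw : IsWeightStructure C le ge) {X Y : C} (e : X ≅ Y) (h : X ∈ ge) : Y ∈ ge :=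
  hw.retract_ge e.inv e.hom e.inv_hom_id h

lemma le_of_iso (hw : IsWeightStructure C le ge) {X Y : C} (e : X ≅ Y) (h : X ∈ le) : Y ∈ le :=
  hw.retract_le e.inv e.hom e.inv_hom_id h

lemma sge_of_iso (hw : IsWeightStructure C le ge) {X Y : C} (e : X ≅ Y) {m : ℤ}
    (h : X ∈ shiftedClass C ge m) : Y ∈ shiftedClass C ge m :=
  ge_of_iso hw ((shiftFunctor C (-m)).mapIso e) h

lemma sle_of_iso (hw : IsWeightStructure C le ge) {X Y : C} (e : X ≅ Y) {m : ℤ}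
    (h : X ∈ shiftedClass C le m) : Y ∈ shiftedClass C le m :=
  le_of_iso hw ((shiftFunctor C (-m)).mapIso e) h

lemma sle_zero (hw : IsWeightStructure C le ge) {X : C} (h : IsZero X) (m : ℤ) :
    X ∈ shiftedClass C le m :=
  hw.zero_le ((shiftFunctor C (-m)).map_isZero h)

lemma sge_anti (hw : IsWeightStructure C le ge) {X : C} {m n : ℤ} (hmn : m ≤ n)
    (h : X ∈ shiftedClass C ge n) : X ∈ shiftedClass C ge m := by
  induction n, hmn using Int.leInduction with
  | base => exact h
  | succ n hn ih =>
    apply ih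
    exact ge_of_iso hw ((shiftFunctorAdd' C (-(n + 1)) 1 (-n) (by omega)).symm.app X)
      (hw.shift_ge h)

lemma orth (hw : IsWeightStructure C le ge) {X Y : C} {m n : ℤ} (hmn : m < n)
    (hX : X ∈ shiftedClass C le m) (hY : Y ∈ shiftedClass C ge n) (f : X ⟶ Y) : f = 0 := by
  have hY' : Y ∈ shiftedClass C ge (m + 1) := sge_anti hw (by omega) hY
  apply (shiftFunctor C (-m)).map_injective
  rw [Functor.map_zero]
  let e := (shiftFunctorAdd' C (-(m + 1)) 1 (-m) (by omega)).app Y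
  have h0 := hw.orthogonal hX hY' ((shiftFunctor C (-m)).map f ≫ e.hom)
  rw [← cancel_mono e.hom, zero_comp]
  exact h0

lemma sle_of_orth (hw : IsWeightStructure C le ge) {X : C} {m : ℤ}
    (h : ∀ Y ∈ shiftedClass C ge (m + 1), ∀ f : X ⟶ Y, f = 0) : X ∈ shiftedClass C le m := by
  obtain ⟨B, A, f, g, d, hB, hA, hT⟩ := hw.exists_decomp (X⟦(-m)⟧)
  have hg : g = 0 := by
    apply (shiftFunctor C m).map_injective
    rw [Functor.map_zero]
    let e := (shiftFunctorCompIsoId C (-m) m (by omega)).app X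
    have hA' : A⟦m⟧ ∈ shiftedClass C ge (m + 1) :=
      ge_of_iso hw ((shiftFunctorAdd' C m (-(m + 1)) (-1) (by omega)).app A) hA
    have h0 := h _ hA' (e.inv ≫ (shiftFunctor C m).map g)
    rw [← cancel_epi e.inv, comp_zero]
    exact h0
  obtain ⟨s, hs⟩ := Triangle.coyoneda_exact₂ _ hT (𝟙 (X⟦(-m)⟧)) (by
    change 𝟙 _ ≫ g = 0
    rw [hg, comp_zero])
  exact hw.retract_le s f hs.symm hB

lemma sle_mono (hw : IsWeightStructure C le ge) {X : C} {m n : ℤ} (hmn : m ≤ n)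
    (h : X ∈ shiftedClass C le m) : X ∈ shiftedClass C le n :=
  sle_of_orth hw fun _ hY f => orth hw (by omega) h hY f

lemma sle_shift (hw : IsWeightStructure C le ge) {X : C} {m : ℤ}
    (h : X ∈ shiftedClass C le (m - 1)) : X⟦(1 : ℤ)⟧ ∈ shiftedClass C le m :=
  le_of_iso hw ((shiftFunctorAdd' C 1 (-m) (-(m - 1)) (by omega)).app X) h

lemma sle_ext₂ (hw : IsWeightStructure C le ge) {X Y Z : C} {f : X ⟶ Y} {g : Y ⟶ Z}
    {d : Z ⟶ X⟦(1 : ℤ)⟧} (hT : Triangle.mk f g d ∈ distTriang C) {m : ℤ}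
    (hX : X ∈ shiftedClass C le m) (hZ : Z ∈ shiftedClass C le m) :
    Y ∈ shiftedClass C le m := by
  refine sle_of_orth hw fun V hV k => ?_
  obtain ⟨l, hl⟩ := Triangle.yoneda_exact₂ _ hT k (orth hw (by omega) hX hV _)
  rw [hl, orth hw (by omega) hZ hV l]
  exact comp_zero

lemma sle_ext₃ (hw : IsWeightStructure C le ge) {X Y Z : C} {f : X ⟶ Y} {g : Y ⟶ Z}
    {d : Z ⟶ X⟦(1 : ℤ)⟧} (hT : Triangle.mk f g d ∈ distTriang C) {m : ℤ}
    (hX : X ∈ shiftedClass C le (m - 1)) (hY : Y ∈ shiftedClass C le m) :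
    Z ∈ shiftedClass C le m := by
  refine sle_of_orth hw fun V hV k => ?_
  obtain ⟨l, hl⟩ := Triangle.yoneda_exact₃ _ hT k (orth hw (by omega) hY hV _)
  rw [hl, orth hw (by omega) (sle_shift hw hX) hV l]
  exact comp_zero

variable {t : TStructure C}

lemma heart_isLE (X : THeart C t) : t.IsLE X.obj 0 := ⟨X.property.1⟩

lemma heart_isGE (X : THeart C t) : t.IsGE X.obj 0 := ⟨X.property.2⟩

/-- A map from `A[1]` to `B` vanishes for `A`, `B` in the heart. -/
lemma heart_shift_zero (A B : THeart C t) (f : A.obj⟦(1 : ℤ)⟧ ⟶ B.obj) : f = 0 := by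
  have := heart_isLE A
  have := heart_isGE B
  have := t.isLE_shift A.obj 0 1 (-1) (by omega)
  exact t.zero f (-1) 0

/-- The first map of a distinguished triangle in the heart is a monomorphism. -/
lemma heart_mono {A B Q : THeart C t} (f : A ⟶ B) {g : B.obj ⟶ Q.obj}
    {d : Q.obj ⟶ A.obj⟦(1 : ℤ)⟧} (hT : Triangle.mk f.hom g d ∈ distTriang C) : Mono f := by
  refine Preadditive.mono_of_cancel_zero _ fun {Z} k hk => ?_
  have hk' : k.hom ≫ f.hom = 0 := congrArg (fun x => x.hom) hk
  apply ObjectProperty.hom_ext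
  change k.hom = 0
  apply (shiftFunctor C (1 : ℤ)).map_injective
  rw [Functor.map_zero]
  obtain ⟨l, hl⟩ := Triangle.coyoneda_exact₁ _ hT (k.hom⟦(1 : ℤ)⟧') (by
    change k.hom⟦(1 : ℤ)⟧' ≫ f.hom⟦(1 : ℤ)⟧' = 0
    rw [← Functor.map_comp, hk', Functor.map_zero])
  change Z.obj⟦(1 : ℤ)⟧ ⟶ Q.obj at l
  refine hl.trans ?_
  rw [heart_shift_zero Z Q l]
  exact zero_comp

/-- The third object of a distinguished triangle in the heart is the cokernel. -/
lemma heart_coker [HasCokernels (THeart C t)] {A B Q : THeart C t} {f : A ⟶ B} {g : B ⟶ Q}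
    {d : Q.obj ⟶ A.obj⟦(1 : ℤ)⟧} (hT : Triangle.mk f.hom g.hom d ∈ distTriang C)
    {A' : THeart C t} (s : A' ⟶ B) (a : A ⟶ A') (ha : a ≫ s = f) (hs : s ≫ g = 0) :
    ∃ e : Q ≅ cokernel s, g ≫ e.hom = cokernel.π s := by
  have h1 : f ≫ cokernel.π s = 0 := by rw [← ha, Category.assoc, cokernel.condition, comp_zero]
  obtain ⟨u, hu⟩ := Triangle.yoneda_exact₂ _ hT (cokernel.π s).hom
    (congrArg (fun x => x.hom) h1)
  change Q.obj ⟶ _ at u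
  let u' : Q ⟶ cokernel s := ObjectProperty.homMk u
  have hu' : g ≫ u' = cokernel.π s := ObjectProperty.hom_ext _ hu.symm
  refine ⟨⟨u', cokernel.desc s g hs, ?_, ?_⟩, hu'⟩
  · rw [← sub_eq_zero]
    have h2 : g ≫ (u' ≫ cokernel.desc s g hs - 𝟙 Q) = 0 := by
      rw [Preadditive.comp_sub, ← Category.assoc, hu', cokernel.π_desc, Category.comp_id, sub_self]
    obtain ⟨l, hl⟩ := Triangle.yoneda_exact₃ _ hT (u' ≫ cokernel.desc s g hs - 𝟙 Q).hom
      (congrArg (fun x => x.hom) h2)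
    apply ObjectProperty.hom_ext
    change A.obj⟦(1 : ℤ)⟧ ⟶ _ at l
    rw [hl, heart_shift_zero A Q l]
    exact comp_zero
  · rw [← cancel_epi (cokernel.π s), ← Category.assoc, cokernel.π_desc, hu', Category.comp_id]

/-- A monomorphism in the heart has its cone in the heart. -/
lemma heart_cone_s9 {A B : THeart C t} (f : A ⟶ B) [Mono f] :
    ∃ (Q : THeart C t) (g : B ⟶ Q) (d : Q.obj ⟶ A.obj⟦(1 : ℤ)⟧),
      Triangle.mk f.hom g.hom d ∈ distTriang C := by
  obtain ⟨K, g, d, hT⟩ := distinguished_cocone_triangle f.hom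
  have := heart_isLE A
  have := heart_isGE A
  have := heart_isLE B
  have := heart_isGE B
  have hA1 := t.isLE_shift A.obj 0 1 (-1) (by omega)
  have hA2 := t.isGE_shift A.obj 0 1 (-1) (by omega)
  have hrot := rot_of_distTriang _ hT
  have hK1 : t.IsLE K 0 := t.isLE₂ _ hrot 0 (heart_isLE B) (t.isLE_of_le (A.obj⟦(1 : ℤ)⟧) (-1) 0)
  have hK2 : t.IsGE K (-1) := t.isGE₂ _ hrot (-1) (t.isGE_of_ge B.obj (-1) 0) hA2
  have hK3 : t.IsGE K 0 := by
    obtain ⟨X, Y, hX, hY, i, p, δ, hT'⟩ := t.exists_triangle K (-1) 0 (by omega)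
    have hX' : t.IsLE X (-1) := ⟨hX⟩
    have hY' : t.IsGE Y 0 := ⟨hY⟩
    have hX2 : t.IsGE X (-1) := by
      have hY2 := t.isGE_shift Y 0 (-1) 1 (by omega)
      exact t.isGE₂ _ (inv_rot_of_distTriang _ hT') (-1)
        (t.isGE_of_ge (Y⟦(-1 : ℤ)⟧) (-1) 1) hK2
    have hZ1 := t.isLE_shift X (-1) (-1) 0 (by omega)
    have hZ2 := t.isGE_shift X (-1) (-1) 0 (by omega)
    let Z : THeart C t := ⟨X⟦(-1 : ℤ)⟧, hZ1.le, hZ2.ge⟩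
    let e : Z.obj⟦(1 : ℤ)⟧ ≅ X := (shiftFunctorCompIsoId C (-1 : ℤ) 1 (by omega)).app X
    obtain ⟨k, hk⟩ := (shiftFunctor C (1 : ℤ)).map_surjective (e.hom ≫ i ≫ d)
    have hdf : d ≫ f.hom⟦(1 : ℤ)⟧' = 0 := comp_distTriang_mor_zero₃₁ _ hT
    have hkf : k ≫ f.hom = 0 := by
      apply (shiftFunctor C (1 : ℤ)).map_injective
      rw [Functor.map_comp, hk, Functor.map_zero, Category.assoc, Category.assoc, hdf,
        comp_zero, comp_zero]
    let k' : Z ⟶ A := ObjectProperty.homMk k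
    have hk0 : k' = 0 := by
      rw [← cancel_mono f, zero_comp]
      exact ObjectProperty.hom_ext _ hkf
    have hk1 : k = 0 := congrArg (fun x => x.hom) hk0
    have hid : i ≫ d = 0 := by
      rw [← cancel_epi e.hom, ← hk, hk1, Functor.map_zero, comp_zero]
    obtain ⟨l, hl⟩ := Triangle.coyoneda_exact₃ _ hT i hid
    change X ⟶ B.obj at l
    have hi : i = 0 := by
      rw [hl, t.zero l (-1) 0]
      exact zero_comp
    obtain ⟨r, hr⟩ := Triangle.yoneda_exact₂ _ hT' (𝟙 K) (by
      change i ≫ 𝟙 K = 0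
      rw [hi, zero_comp])
    change Y ⟶ K at r
    change 𝟙 K = p ≫ r at hr
    rw [t.isGE_iff_orthogonal (-1) 0 (by omega)]
    intro V v hV
    rw [← Category.comp_id v, hr, ← Category.assoc, t.zero (v ≫ p) (-1) 0, zero_comp]
  exact ⟨⟨K, hK1.le, hK3.ge⟩, ObjectProperty.homMk g, d, hT⟩

lemma nice (htr : Transversal C le ge t) (X : THeart C t) (m : ℤ) :
    ∃ (W B : THeart C t) (f : W ⟶ X) (g : X ⟶ B) (h : B.obj ⟶ W.obj⟦(1 : ℤ)⟧),
    (Triangle.mk f.hom g.hom h ∈ distTriang C) ∧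
    W.obj ∈ shiftedClass C le m ∧ B.obj ∈ shiftedClass C ge (m + 1) := by
  obtain ⟨W, B, f, g, h, hT, h1, h2, h3, h4⟩ := htr X.obj X.property m
  exact ⟨⟨W, h3⟩, ⟨B, h4⟩, ObjectProperty.homMk f, ObjectProperty.homMk g, h, hT, h1, h2⟩

lemma lift_of_dist {A B Q : THeart C t} {f : A ⟶ B} {g : B ⟶ Q}
    {d : Q.obj ⟶ A.obj⟦(1 : ℤ)⟧} (hT : Triangle.mk f.hom g.hom d ∈ distTriang C)
    {V : THeart C t} (v : V ⟶ B) (hv : v.hom ≫ g.hom = 0) : ∃ u : V ⟶ A, u ≫ f = v := by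
  obtain ⟨l, hl⟩ := Triangle.coyoneda_exact₂ _ hT v.hom hv
  exact ⟨ObjectProperty.homMk l, ObjectProperty.hom_ext _ hl.symm⟩

lemma heartFilt_exists (hw : IsWeightStructure C le ge) (hbw : WBounded C le ge)
    (htr : Transversal C le ge t) [HasCokernels (THeart C t)] (X : THeart C t) :
    Nonempty (HeartFilt C le ge t X) := by
  choose W B f g d hT hW hB using nice htr X
  have hmono : ∀ m, Mono (f m) := fun m => heart_mono (f m) (hT m)
  have hσ : ∀ m, ∃ s : W (m - 1) ⟶ W m, s ≫ f m = f (m - 1) := fun m =>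
    lift_of_dist (hT m) (f (m - 1)) (orth hw (by omega) (hW (m - 1)) (hB m) _)
  choose σ hσ using hσ
  refine ⟨⟨W, f, σ, hmono, hσ, ?_, ?_, ?_⟩⟩
  · obtain ⟨i, hi⟩ := (hbw X.obj).2
    refine ⟨i - 1, fun m hm => ?_⟩
    have h0 : f m = 0 := ObjectProperty.hom_ext _ (orth hw (by omega) (hW m) hi (f m).hom)
    rw [IsZero.iff_id_eq_zero]
    have := hmono m
    rw [← cancel_mono (f m), h0, comp_zero, comp_zero]
  · obtain ⟨i, hi⟩ := (hbw X.obj).1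
    refine ⟨i, fun m hm => ?_⟩
    have h0 : (g m).hom = 0 := orth hw (by omega) hi (hB m) _
    obtain ⟨s, hs⟩ := lift_of_dist (hT m) (𝟙 X) (by rw [h0, comp_zero])
    have := hmono m
    refine ⟨s, ?_, hs⟩
    rw [← cancel_mono (f m), Category.assoc, hs, Category.comp_id, Category.id_comp]
  · intro m
    obtain ⟨W', B', f', g', d', hT', hW', hB'⟩ := nice htr (W m) (m - 1)
    obtain ⟨a, ha⟩ := lift_of_dist (hT (m - 1)) (f' ≫ f m)
      (orth hw (by omega) hW' (hB (m - 1)) _)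
    have hσg : σ m ≫ g' = 0 :=
      ObjectProperty.hom_ext _ (orth hw (by omega) (hW (m - 1)) hB' _)
    have haf : a ≫ σ m = f' := by
      have := hmono m
      rw [← cancel_mono (f m), Category.assoc, hσ, ha]
    obtain ⟨e, -⟩ := heart_coker hT' (σ m) a haf hσg
    have e' := (heartIncl C t).mapIso e
    exact ⟨sle_of_iso hw e' (sle_ext₃ hw hT' hW' (hW m)),
      sge_of_iso hw e' (sge_anti hw (by omega) hB')⟩

lemma heartFilt_dist (hw : IsWeightStructure C le ge) [HasCokernels (THeart C t)]
    {X : THeart C t} (F : HeartFilt C le ge t X) (m : ℤ) :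
    ∃ (Q : THeart C t) (g : F.W m ⟶ Q) (d : Q.obj ⟶ (F.W (m - 1)).obj⟦(1 : ℤ)⟧),
      (Triangle.mk (F.σ m).hom g.hom d ∈ distTriang C) ∧ Q.obj ∈ wEq C le ge m := by
  have h1 : Mono (F.σ m ≫ F.ι m) := by rw [F.compat]; exact F.mono _
  have : Mono (F.σ m) := mono_of_mono _ (F.ι m)
  obtain ⟨Q, g, d, hT⟩ := heart_cone_s9 (F.σ m)
  have hz : F.σ m ≫ g = 0 := ObjectProperty.hom_ext _ (comp_distTriang_mor_zero₁₂ _ hT)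
  obtain ⟨e, -⟩ := heart_coker hT (F.σ m) (𝟙 _) (Category.id_comp _) hz
  have e' := (heartIncl C t).mapIso e.symm
  exact ⟨Q, g, d, hT, sle_of_iso hw e' (F.graded m).1, sge_of_iso hw e' (F.graded m).2⟩

lemma heartFilt_le (hw : IsWeightStructure C le ge) [HasCokernels (THeart C t)]
    {X : THeart C t} (F : HeartFilt C le ge t X) (m : ℤ) :
    (F.W m).obj ∈ shiftedClass C le m := by
  obtain ⟨a, ha⟩ := F.eventually_zero
  have hz : ∀ m ≤ a, (F.W m).obj ∈ shiftedClass C le m := fun m hm =>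
    sle_zero hw ((heartIncl C t).map_isZero (ha m hm)) m
  have key : ∀ n : ℕ, (F.W (a + n)).obj ∈ shiftedClass C le (a + n) := by
    intro n
    induction n with
    | zero => exact hz _ (by simp)
    | succ n ih =>
      obtain ⟨Q, g, d, hT, hQ⟩ := heartFilt_dist hw F (a + (n + 1 : ℕ))
      refine sle_ext₂ hw hT ?_ hQ.1
      have h : a + ((n + 1 : ℕ) : ℤ) - 1 = a + n := by push_cast; omega
      rw [h]
      exact sle_mono hw (by push_cast; omega) ih
  rcases le_total m a with h | h
  · exact hz m h
  · obtain ⟨n, rfl⟩ := Int.le.dest h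
    exact key n

lemma heartFilt_lift (hw : IsWeightStructure C le ge) [HasCokernels (THeart C t)]
    {Y : THeart C t} (G : HeartFilt C le ge t Y) (m : ℤ) (V : THeart C t)
    (hV : V.obj ∈ shiftedClass C le m) (v : V ⟶ Y) : ∃ u : V ⟶ G.W m, u ≫ G.ι m = v := by
  obtain ⟨b, hb⟩ := G.eventually_all
  have key : ∀ (n : ℕ) (k : ℤ), m ≤ k → b ≤ k + n → ∃ u : V ⟶ G.W k, u ≫ G.ι k = v := by
    intro n
    induction n with
    | zero =>
      intro k _ hk
      have := hb k (by simpa using hk)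
      exact ⟨v ≫ inv (G.ι k), by simp⟩
    | succ n ih =>
      intro k hmk hk
      obtain ⟨u, hu⟩ := ih (k + 1) (by omega) (by push_cast at hk; omega)
      obtain ⟨Q, g, d, hT, hQ⟩ := heartFilt_dist hw G (k + 1)
      obtain ⟨u', hu'⟩ := lift_of_dist hT u (orth hw (by omega) hV hQ.2 _)
      have h : ∃ u : V ⟶ G.W (k + 1 - 1), u ≫ G.ι (k + 1 - 1) = v :=
        ⟨u', by rw [← G.compat, ← Category.assoc, hu', hu]⟩
      rwa [show k + 1 - 1 = k by omega] at h
  exact key (b - m).toNat m le_rfl (by omega)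

end Helpers

/-- If bounded `t` is transversal to bounded `w`, every object
`X` of the heart admits an increasing filtration by subobjects `W_{≤m}X`, zero
for small `m` and equal to `X` for large `m`, whose `m`-th graded factor lies in
`A_m = C^{t=0} ∩ C_{w=m}`; moreover this filtration is unique and functorial. -/
theorem statement9 (le ge : Set C) (hw : IsWeightStructure C le ge)
    (hbw : WBounded C le ge) (t : TStructure C) (hbt : TBounded C t)
    (htr : Transversal C le ge t) [HasCokernels (THeart C t)] :
    (∀ X : THeart C t, Nonempty (HeartFilt C le ge t X)) ∧
    (∀ (X : THeart C t) (F G : HeartFilt C le ge t X) (m : ℤ),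
      ∃ e : F.W m ≅ G.W m, e.hom ≫ G.ι m = F.ι m) ∧
    (∀ (X Y : THeart C t) (f : X ⟶ Y) (F : HeartFilt C le ge t X)
        (G : HeartFilt C le ge t Y) (m : ℤ),
      ∃ g : F.W m ⟶ G.W m, g ≫ G.ι m = F.ι m ≫ f) := by
  have func : ∀ (X Y : THeart C t) (f : X ⟶ Y) (F : HeartFilt C le ge t X)
        (G : HeartFilt C le ge t Y) (m : ℤ),
      ∃ g : F.W m ⟶ G.W m, g ≫ G.ι m = F.ι m ≫ f := fun X Y f F G m =>
    heartFilt_lift hw G m (F.W m) (heartFilt_le hw F m) (F.ι m ≫ f)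
  refine ⟨heartFilt_exists hw hbw htr, fun X F G m => ?_, func⟩
  obtain ⟨u, hu⟩ := func X X (𝟙 X) F G m
  obtain ⟨v, hv⟩ := func X X (𝟙 X) G F m
  rw [Category.comp_id] at hu hv
  have := F.mono m
  have := G.mono m
  refine ⟨⟨u, v, ?_, ?_⟩, hu⟩
  · rw [← cancel_mono (F.ι m), Category.assoc, hv, hu, Category.id_comp]
  · rw [← cancel_mono (G.ι m), Category.assoc, hu, hv, Category.id_comp]

end PaperWeights
end

section
/- Let w be a bounded weight structure and t a bounded t-structure on a triangulated category C. For m ∈ ℤ and X ∈ C^{t=0}, choose any weight decomposition w_{≤m}X → X → w_{≥m+1}X and let f_m(X) : W_m H^t_0(X) → X be the canonical monomorphism in Ht, where W_m H^t_0(X) = Im(H^t_0(w_{≤m}X) → H^t_0(X)) and H^t_0(X) is identified with X. Then t is transversal to w if and only if for every m ∈ ℤ and every X ∈ C^{t=0} the morphism f_m(X) extends to a nice decomposition of X, i.e. there is a distinguished triangle W_m H^t_0(X) → X → B → W_m H^t_0(X)[1] whose first morphism is f_m(X), with W_m H^t_0(X) ∈ C_{w≤m} ∩ C^{t=0} and B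 ∈ C_{w≥m+1} ∩ C^{t=0}. -/
namespace PaperWeights

open CategoryTheory CategoryTheory.Limits CategoryTheory.Pretriangulated CategoryTheory.Triangulated

universe v u

variable (C : Type u) [Category.{v} C] [HasZeroObject C] [Preadditive C] [HasShift C ℤ]
  [∀ n : ℤ, (shiftFunctor C n).Additive] [Pretriangulated C]

variable {C}

section Helpers

lemma shiftedClass_of_iso {P : Set C}
    (hP : ∀ ⦃X Y : C⦄ (s : X ⟶ Y) (r : Y ⟶ X), s ≫ r = 𝟙 X → Y ∈ P → X ∈ P)
    {X Y : C} (e : X ≅ Y) (i : ℤ) (hY : Y ∈ shiftedClass C P i) : X ∈ shiftedClass C P i :=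
  hP (e.hom⟦-i⟧') (e.inv⟦-i⟧')
    (by rw [← Functor.map_comp, e.hom_inv_id, CategoryTheory.Functor.map_id]) hY

lemma weight_orthogonal {le ge : Set C} (hw : IsWeightStructure C le ge) {X Y : C} (m : ℤ)
    (hX : X ∈ shiftedClass C le m) (hY : Y ∈ shiftedClass C ge (m + 1)) (f : X ⟶ Y) : f = 0 := by
  let e : Y⟦-m⟧ ≅ (Y⟦-(m + 1)⟧)⟦(1 : ℤ)⟧ :=
    (shiftFunctorAdd' C (-(m + 1)) 1 (-m) (by lia)).app Y
  have h := hw.orthogonal hX hY (f⟦-m⟧' ≫ e.hom)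
  have h2 : f⟦-m⟧' = 0 := by
    rw [← cancel_mono e.hom, h, zero_comp]
  apply (shiftFunctor C (-m)).map_injective
  rw [h2, Functor.map_zero]

lemma exists_weight_decomp {le ge : Set C} (hw : IsWeightStructure C le ge) (X : C) (m : ℤ) :
    ∃ (A B : C) (f : A ⟶ X) (g : X ⟶ B) (h : B ⟶ A⟦(1 : ℤ)⟧),
      (Triangle.mk f g h ∈ distTriang C) ∧ A ∈ shiftedClass C le m ∧
        B ∈ shiftedClass C ge (m + 1) := by
  obtain ⟨A, B, f, g, h, hA, hB, mem⟩ := hw.exists_decomp (X⟦-m⟧)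
  let T := (Triangle.shiftFunctor C m).obj (Triangle.mk f g h)
  let e : T.obj₂ ≅ X := (shiftFunctorCompIsoId C (-m) m (by lia)).app X
  have hT' : Triangle.mk (T.mor₁ ≫ e.hom) (e.inv ≫ T.mor₂) T.mor₃ ∈ distTriang C := by
    refine isomorphic_distinguished _ (Triangle.shift_distinguished _ mem m) _ ?_
    refine Triangle.isoMk _ _ (Iso.refl _) e.symm (Iso.refl _) ?_ ?_ ?_
    · change (T.mor₁ ≫ e.hom) ≫ e.inv = 𝟙 _ ≫ T.mor₁
      rw [Category.assoc, e.hom_inv_id, Category.comp_id, Category.id_comp]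
    · change (e.inv ≫ T.mor₂) ≫ 𝟙 _ = e.inv ≫ T.mor₂
      rw [Category.comp_id]
    · change T.mor₃ ≫ (𝟙 _)⟦1⟧' = 𝟙 _ ≫ T.mor₃
      rw [CategoryTheory.Functor.map_id, Category.comp_id, Category.id_comp]
  refine ⟨A⟦m⟧, B⟦m⟧, _, _, _, hT', ?_, ?_⟩
  · let i : (A⟦m⟧)⟦-m⟧ ≅ A := (shiftFunctorCompIsoId C m (-m) (by lia)).app A
    exact hw.retract_le i.hom i.inv i.hom_inv_id hA
  · let i : B⟦(-1 : ℤ)⟧ ≅ (B⟦m⟧)⟦-(m + 1)⟧ :=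
      (shiftFunctorAdd' C m (-(m + 1)) (-1) (by lia)).app B
    exact hw.retract_ge i.inv i.hom i.inv_hom_id hB

/-- The first morphism of a triangle in the heart is a monomorphism on `t ≤ 0`. -/
lemma eq_zero_of_comp {t : TStructure C} {W X B Z : C} {f : W ⟶ X} {g : X ⟶ B}
    {h : B ⟶ W⟦(1 : ℤ)⟧} (hT : Triangle.mk f g h ∈ distTriang C) (hB : t.ge 0 B)
    (hZ : t.le 0 Z) (u : Z ⟶ W) (hu : u ≫ f = 0) : u = 0 := by
  have hex : ∃ v : Z⟦(1 : ℤ)⟧ ⟶ B, u⟦(1 : ℤ)⟧' = v ≫ h :=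
    Triangle.coyoneda_exact₁ _ hT (u⟦(1 : ℤ)⟧') (by
    change u⟦(1 : ℤ)⟧' ≫ f⟦(1 : ℤ)⟧' = 0
    rw [← Functor.map_comp, hu, Functor.map_zero])
  obtain ⟨v, hv⟩ := hex
  have hv0 : v = 0 := by
    have : t.IsLE (Z⟦(1 : ℤ)⟧) (-1) := ⟨t.le_shift 0 1 (-1) (by lia) _ hZ⟩
    have : t.IsGE B 0 := ⟨hB⟩
    exact t.zero v (-1) 0 (by lia)
  apply (shiftFunctor C (1 : ℤ)).map_injective
  rw [hv, hv0, Functor.map_zero, zero_comp]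

variable {t : TStructure C} (τ : TruncData C t)

lemma TruncData.isIso_ε {X : C} (hX : t.le 0 X) : IsIso (τ.εLE.app X) := by
  obtain ⟨s, hs⟩ := (τ.le_univ X X hX).2 (𝟙 X)
  change s ≫ τ.εLE.app X = 𝟙 X at hs
  refine ⟨s, (τ.le_univ _ X (τ.mem_le X)).1 ?_, hs⟩
  change (τ.εLE.app X ≫ s) ≫ τ.εLE.app X = 𝟙 _ ≫ τ.εLE.app X
  rw [Category.assoc, hs, Category.id_comp]
  exact Category.comp_id _

lemma TruncData.isIso_η {X : C} (hX : t.ge 0 X) : IsIso (τ.ηGE.app X) := by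
  obtain ⟨s, hs⟩ := (τ.ge_univ X X hX).2 (𝟙 X)
  change τ.ηGE.app X ≫ s = 𝟙 X at hs
  refine ⟨s, hs, (τ.ge_univ X _ (τ.mem_ge X)).1 ?_⟩
  change τ.ηGE.app X ≫ s ≫ τ.ηGE.app X = τ.ηGE.app X ≫ 𝟙 _
  rw [← Category.assoc, hs, Category.comp_id]
  exact Category.id_comp _

/-- canonical identification -/
lemma TruncData.exists_can :
    ∃ can : ∀ X : THeart C t, τ.truncGE.obj (τ.truncLE.obj X.obj) ≅ X.obj,
      ∀ (X Y : THeart C t) (f : X.obj ⟶ Y.obj),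
        τ.truncGE.map (τ.truncLE.map f) ≫ (can Y).hom = (can X).hom ≫ f := by
  have hε : ∀ X : THeart C t, IsIso (τ.εLE.app X.obj) := fun X => τ.isIso_ε X.property.1
  have hη : ∀ X : THeart C t, IsIso (τ.ηGE.app (τ.truncLE.obj X.obj)) := fun X =>
    τ.isIso_η ((t.ge 0).prop_of_iso (asIso (τ.εLE.app X.obj)).symm X.property.2)
  let a : ∀ X : THeart C t, τ.truncLE.obj X.obj ≅ τ.truncGE.obj (τ.truncLE.obj X.obj) :=
    fun X => asIso (τ.ηGE.app (τ.truncLE.obj X.obj))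
  let b : ∀ X : THeart C t, τ.truncLE.obj X.obj ≅ X.obj := fun X => asIso (τ.εLE.app X.obj)
  refine ⟨fun X => (a X).symm ≪≫ b X, fun X Y f => ?_⟩
  have h1 : (a X).hom ≫ τ.truncGE.map (τ.truncLE.map f) = τ.truncLE.map f ≫ (a Y).hom :=
    (τ.ηGE.naturality (τ.truncLE.map f)).symm
  have h2 : τ.truncLE.map f ≫ (b Y).hom = (b X).hom ≫ f := τ.εLE.naturality f
  change τ.truncGE.map (τ.truncLE.map f) ≫ (a Y).inv ≫ (b Y).hom =
    ((a X).inv ≫ (b X).hom) ≫ f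
  rw [Category.assoc, ← h2, Iso.eq_inv_comp, reassoc_of% h1, Iso.hom_inv_id_assoc]

end Helpers

variable (C)
/-- For bounded `w` and bounded `t`, the structure `t` is
transversal to `w` if and only if for every `m ∈ ℤ`, every `X ∈ C^{t=0}` and
every weight decomposition `w_{≤m}X → X → w_{≥m+1}X`, the canonical monomorphism
`f_m(X) : W_m H^t_0(X) = Im (H^t_0(w_{≤m}X) → H^t_0(X)) ⟶ X` extends to a nice
decomposition of `X` for `m`. -/
theorem statement11 (le ge : Set C) (hw : IsWeightStructure C le ge)
    (hbw : WBounded C le ge) (t : TStructure C) (hbt : TBounded C t)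
    (τ : TruncData C t) [HasImages (THeart C t)] :
    Transversal C le ge t ↔
      ∀ (m : ℤ) (X : THeart C t) (A B : C) (f : A ⟶ X.obj) (g : X.obj ⟶ B)
        (h : B ⟶ A⟦(1 : ℤ)⟧),
        (Triangle.mk f g h ∈ distTriang C) → A ∈ shiftedClass C le m →
        B ∈ shiftedClass C ge (m + 1) →
        ∃ (B' : C) (g' : X.obj ⟶ B')
          (h' : B' ⟶ ((image (τ.H₀.map f ≫ (τ.heartIso X).hom)).obj)⟦(1 : ℤ)⟧),
          (Triangle.mk
            ((heartIncl C t).map (image.ι (τ.H₀.map f ≫ (τ.heartIso X).hom)))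
            g' h' ∈ distTriang C) ∧
          (image (τ.H₀.map f ≫ (τ.heartIso X).hom)).obj ∈ shiftedClass C le m ∧
          B' ∈ shiftedClass C ge (m + 1) ∧ B' ∈ heartSet C t := by
  constructor
  · intro htr m X A B f g h hT hA hB
    obtain ⟨W, B₀, i, p, k, hT₀, hW, hB₀, hWh, hB₀h⟩ := htr X.obj X.property m
    have hexs : ∃ s : W ⟶ A, i = s ≫ f :=
      Triangle.coyoneda_exact₂ _ hT i (weight_orthogonal hw m hW hB _)
    have hexr : ∃ r : A ⟶ W, f = r ≫ i :=
      Triangle.coyoneda_exact₂ _ hT₀ f (weight_orthogonal hw m hA hB₀ _)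
    obtain ⟨s, hs⟩ := hexs
    obtain ⟨r, hr⟩ := hexr
    have hsr : s ≫ r = 𝟙 W := by
      rw [← sub_eq_zero]
      apply eq_zero_of_comp hT₀ hB₀h.2 hWh.1
      rw [Preadditive.sub_comp, Category.assoc, ← hr, ← hs, Category.id_comp, sub_self]
    obtain ⟨can, hcan⟩ := τ.exists_can
    let W' : THeart C t := ⟨W, hWh⟩
    let φ : X.obj ≅ X.obj := (can X).symm ≪≫ τ.isoHeart X.obj X.property
    let mm : W' ⟶ X := ObjectProperty.homMk (i ≫ φ.hom)
    let ee : τ.H₀.obj A ⟶ W' := τ.H₀.map r ≫ ObjectProperty.homMk (can W').hom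
    have hcomm : ee ≫ mm = τ.H₀.map f ≫ (τ.heartIso X).hom := by
      apply ObjectProperty.hom_ext
      change (τ.truncGE.map (τ.truncLE.map r) ≫ (can W').hom) ≫ i ≫ (can X).inv ≫
        (τ.isoHeart X.obj X.property).hom =
        τ.truncGE.map (τ.truncLE.map f) ≫ (τ.isoHeart X.obj X.property).hom
      have := hcan W' X i
      rw [hr, Functor.map_comp, Functor.map_comp, Category.assoc, Category.assoc,
        ← reassoc_of% this, Iso.hom_inv_id_assoc]
    have : Mono mm := by
      refine ⟨fun {Z} a b hab => ?_⟩
      apply ObjectProperty.hom_ext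
      have h1 : a.hom ≫ i ≫ φ.hom = b.hom ≫ i ≫ φ.hom := congrArg (fun q => q.hom) hab
      rw [← Category.assoc, ← Category.assoc, cancel_mono] at h1
      rw [← sub_eq_zero]
      apply eq_zero_of_comp hT₀ hB₀h.2 Z.property.1
      rw [Preadditive.sub_comp, h1, sub_self]
    let sec : W' ⟶ τ.H₀.obj A := ObjectProperty.homMk (can W').inv ≫ τ.H₀.map s
    have hsec : sec ≫ ee = 𝟙 W' := by
      apply ObjectProperty.hom_ext
      change ((can W').inv ≫ τ.truncGE.map (τ.truncLE.map s)) ≫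
        τ.truncGE.map (τ.truncLE.map r) ≫ (can W').hom = 𝟙 W
      rw [Category.assoc, ← Functor.map_comp_assoc, ← Functor.map_comp, hsr,
        CategoryTheory.Functor.map_id, CategoryTheory.Functor.map_id, Category.id_comp, Iso.inv_hom_id]
    have : IsSplitEpi ee := ⟨⟨⟨sec, hsec⟩⟩⟩
    let F : StrongEpiMonoFactorisation (τ.H₀.map f ≫ (τ.heartIso X).hom) :=
      { I := W', m := mm, e := ee, fac := hcomm }
    let I : W' ≅ image (τ.H₀.map f ≫ (τ.heartIso X).hom) :=
      IsImage.isoExt F.toMonoIsImage (Image.isImage _)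
    have hI : I.inv ≫ mm = image.ι (τ.H₀.map f ≫ (τ.heartIso X).hom) :=
      IsImage.lift_fac (Image.isImage _) F.toMonoFactorisation
    let J : (image (τ.H₀.map f ≫ (τ.heartIso X).hom)).obj ≅ W :=
      (heartIncl C t).mapIso I.symm
    have hJ : J.hom ≫ i ≫ φ.hom =
        (heartIncl C t).map (image.ι (τ.H₀.map f ≫ (τ.heartIso X).hom)) :=
      congrArg (fun q => (heartIncl C t).map q) hI
    refine ⟨B₀, φ.inv ≫ p, k ≫ J.inv⟦(1 : ℤ)⟧', ?_, shiftedClass_of_iso hw.retract_le J m hW,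
      hB₀, hB₀h⟩
    rw [← hJ]
    refine isomorphic_distinguished _ hT₀ _ ?_
    refine Triangle.isoMk _ _ J φ.symm (Iso.refl _) ?_ ?_ ?_
    · change (J.hom ≫ i ≫ φ.hom) ≫ φ.inv = J.hom ≫ i
      rw [Category.assoc, Category.assoc, φ.hom_inv_id, Category.comp_id]
    · change (φ.inv ≫ p) ≫ 𝟙 _ = φ.inv ≫ p
      rw [Category.comp_id]
    · change (k ≫ J.inv⟦(1 : ℤ)⟧') ≫ J.hom⟦(1 : ℤ)⟧' = 𝟙 _ ≫ k
      rw [Category.assoc, ← Functor.map_comp, J.inv_hom_id, CategoryTheory.Functor.map_id, Category.comp_id,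
        Category.id_comp]
  · intro H X hX m
    obtain ⟨A, B, f, g, h, hT, hA, hB⟩ := exists_weight_decomp hw X m
    obtain ⟨B', g', h', hT', hI, hB', hB'h⟩ := H m ⟨X, hX⟩ A B f g h hT hA hB
    exact ⟨_, B', _, g', h', hT', hI, hB', ObjectProperty.FullSubcategory.property _, hB'h⟩

end PaperWeights
end
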